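/- arXiv:2105.13883 — 3 statements merged into one kernel-verified Lean document; each statement's English description precedes it below -/
import Mathlib

section
/- Let P_1,…,P_s ∈ ℤ[x_1,…,x_r] (s ≥ 2, r ≥ 1) be nonzero coprime polynomials. Then the set 𝒟 = {d_n : n ∈ ℤ^r} of gcds of values is stable under gcd and under lcm: for all n, m ∈ ℤ^r there exist n', n'' ∈ ℤ^r with gcd(d_n, d_m) = d_{n'} and lcm(d_n, d_m) = d_{n''}. -/
open MvPolynomial

section ClearDenominators

open Polynomial

variable {A : Type*} [CommRing A] [IsDomain A]

lemma exists_map_eq_C_mul {ι K : Type*} [Finite ι] [Field K] [Algebra A K] [IsFractionRing A K]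
    (g : ι → K[X]) :
    ∃ b : A, b ≠ 0 ∧ ∃ h : ι → A[X],
      ∀ i, (h i).map (algebraMap A K) = Polynomial.C (algebraMap A K b) * g i := by
  classical
  cases nonempty_fintype ι
  choose b hb hg using fun i =>
    IsLocalization.integerNormalization_spec (nonZeroDivisors A) (g i)
  refine ⟨∏ i, b i, Finset.prod_ne_zero_iff.mpr fun i _ => nonZeroDivisors.ne_zero (hb i),
    fun i => Polynomial.C (∏ j ∈ Finset.univ.erase i, b j) *
      IsLocalization.integerNormalization (nonZeroDivisors A) (g i), fun i => ?_⟩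
  rw [Polynomial.map_mul, Polynomial.map_C, hg, ← Finset.prod_erase_mul _ b (Finset.mem_univ i),
    map_mul, map_mul, mul_assoc, Algebra.smul_def, IsScalarTower.algebraMap_apply A K K[X],
    Polynomial.algebraMap_apply, Algebra.algebraMap_self, RingHom.id_apply]

lemma exists_pseudo_gcd (F G : A[X]) :
    ∃ (D F' G' a b : A[X]) (c : A), c ≠ 0 ∧
      Polynomial.C c * F = D * F' ∧ Polynomial.C c * G = D * G' ∧ Polynomial.C c * D = a * F + b * G := by
  classical
  let K := FractionRing A
  let f := Polynomial.map (algebraMap A K) F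
  let g := Polynomial.map (algebraMap A K) G
  obtain ⟨F₀, hF₀⟩ := EuclideanDomain.gcd_dvd_left f g
  obtain ⟨G₀, hG₀⟩ := EuclideanDomain.gcd_dvd_right f g
  have hD := EuclideanDomain.gcd_eq_gcd_ab f g
  obtain ⟨c, hc, h, hh⟩ := exists_map_eq_C_mul (A := A)
    ![EuclideanDomain.gcd f g, F₀, G₀, EuclideanDomain.gcdA f g, EuclideanDomain.gcdB f g]
  have inj := Polynomial.map_injective _ (IsFractionRing.injective A K)
  have h0 := hh 0
  have h1 := hh 1
  have h2 := hh 2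
  have h3 := hh 3
  have h4 := hh 4
  simp only [Matrix.cons_val] at h0 h1 h2 h3 h4
  refine ⟨h 0, h 1, h 2, Polynomial.C (c * c) * h 3, Polynomial.C (c * c) * h 4, c * c, mul_ne_zero hc hc, inj ?_, inj ?_, inj ?_⟩
  · simp only [Polynomial.map_mul, Polynomial.map_C, map_mul, h0, h1]
    change _ * f = _
    linear_combination (Polynomial.C (algebraMap A K c)) ^ 2 * hF₀
  · simp only [Polynomial.map_mul, Polynomial.map_C, map_mul, h0, h2]
    change _ * g = _
    linear_combination (Polynomial.C (algebraMap A K c)) ^ 2 * hG₀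
  · simp only [Polynomial.map_mul, Polynomial.map_add, Polynomial.map_C, map_mul, h0, h3, h4]
    change _ = _ * f + _ * g
    linear_combination (Polynomial.C (algebraMap A K c)) ^ 3 * hD

end ClearDenominators

section Radial

variable {σ R : Type*} [CommRing R]

/-- The substitution `x ↦ n + t • x`, as a map into polynomials in `t`. -/
noncomputable def radial (n : σ → R) : MvPolynomial σ R →+* Polynomial (MvPolynomial σ R) :=
  eval₂Hom (Polynomial.C.comp C)
    fun i => Polynomial.C (C (n i)) + Polynomial.X * Polynomial.C (X i)

/-- The extension of `radial n` fixing `t`. -/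
noncomputable def radialExtend (n : σ → R) :
    Polynomial (MvPolynomial σ R) →+* Polynomial (MvPolynomial σ R) :=
  Polynomial.eval₂RingHom (radial n) Polynomial.X

lemma radialExtend_C (n : σ → R) (f : MvPolynomial σ R) :
    radialExtend n (Polynomial.C f) = radial n f := by
  simp [radialExtend]

lemma radialExtend_X (n : σ → R) : radialExtend n Polynomial.X = Polynomial.X := by
  simp [radialExtend]

lemma radialExtend_injective [IsDomain R] (n : σ → R) :
    Function.Injective (radialExtend n) := by
  let L := FractionRing (Polynomial (MvPolynomial σ R))
  let ι : Polynomial (MvPolynomial σ R) →+* L := algebraMap _ L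
  have hι : Function.Injective ι := IsFractionRing.injective _ L
  have hX : ι Polynomial.X ≠ 0 := (map_ne_zero_iff ι hι).mpr Polynomial.X_ne_zero
  let ψ : Polynomial (MvPolynomial σ R) →+* L :=
    Polynomial.eval₂RingHom
      (eval₂Hom (ι.comp (Polynomial.C.comp C)) fun i =>
        (ι (Polynomial.C (X i)) - ι (Polynomial.C (C (n i)))) / ι Polynomial.X)
      (ι Polynomial.X)
  have hψ : ψ.comp (radialExtend n) = ι := by
    refine Polynomial.ringHom_ext' (MvPolynomial.ringHom_ext ?_ ?_) ?_
    · intro r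
      simp [ψ, radialExtend, radial]
    · intro i
      simp [ψ, radialExtend, radial, div_mul_cancel₀ _ hX]
    · simp [ψ, radialExtend]
  exact Function.Injective.of_comp (f := ψ) (by rw [← RingHom.coe_comp, hψ]; exact hι)

lemma exists_X_pow_mul_eq_radialExtend (n : σ → R) (H : Polynomial (MvPolynomial σ R)) :
    ∃ (N : ℕ) (H' : Polynomial (MvPolynomial σ R)),
      Polynomial.X ^ N * H = radialExtend n H' := by
  have mul : ∀ H₁ H₂ : Polynomial (MvPolynomial σ R),
      (∃ (N : ℕ) (H' : _), Polynomial.X ^ N * H₁ = radialExtend n H') →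
      (∃ (N : ℕ) (H' : _), Polynomial.X ^ N * H₂ = radialExtend n H') →
      ∃ (N : ℕ) (H' : _), Polynomial.X ^ N * (H₁ * H₂) = radialExtend n H' := by
    rintro H₁ H₂ ⟨N, H₁', h₁⟩ ⟨M, H₂', h₂⟩
    exact ⟨N + M, H₁' * H₂', by rw [map_mul, ← h₁, ← h₂]; ring⟩
  have add : ∀ H₁ H₂ : Polynomial (MvPolynomial σ R),
      (∃ (N : ℕ) (H' : _), Polynomial.X ^ N * H₁ = radialExtend n H') →
      (∃ (N : ℕ) (H' : _), Polynomial.X ^ N * H₂ = radialExtend n H') →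
      ∃ (N : ℕ) (H' : _), Polynomial.X ^ N * (H₁ + H₂) = radialExtend n H' := by
    rintro H₁ H₂ ⟨N, H₁', h₁⟩ ⟨M, H₂', h₂⟩
    exact ⟨N + M, Polynomial.X ^ M * H₁' + Polynomial.X ^ N * H₂', by
      rw [map_add, map_mul, map_mul, ← h₁, ← h₂, map_pow, map_pow, radialExtend_X]; ring⟩
  have hX : ∃ (N : ℕ) (H' : Polynomial (MvPolynomial σ R)),
      Polynomial.X ^ N * Polynomial.X = radialExtend n H' :=
    ⟨0, Polynomial.X, by simp [radialExtend_X]⟩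
  have hC (f : MvPolynomial σ R) : ∃ (N : ℕ) (H' : Polynomial (MvPolynomial σ R)),
      Polynomial.X ^ N * Polynomial.C f = radialExtend n H' := by
    induction f using MvPolynomial.induction_on with
    | C r => exact ⟨0, Polynomial.C (C r), by simp [radialExtend, radial]⟩
    | add p q hp hq => simpa using add _ _ hp hq
    | mul_X p i hp =>
      rw [Polynomial.C_mul]
      refine mul _ _ hp ⟨1, Polynomial.C (X i - C (n i)), ?_⟩
      simp [radialExtend, radial]
  induction H using Polynomial.induction_on with
  | C f => exact hC f
  | add p q hp hq => exact add _ _ hp hq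
  | monomial k f h =>
    rw [pow_succ, ← mul_assoc]
    exact mul _ _ h hX

variable [IsDomain R]

lemma radial_dvd_X_pow_mul_of_dvd_mul {π : MvPolynomial σ R} (hπ : Prime π) (n : σ → R)
    {H₁ H₂ : Polynomial (MvPolynomial σ R)} (h : radial n π ∣ H₁ * H₂) :
    ∃ N : ℕ, radial n π ∣ Polynomial.X ^ N * H₁ ∨ radial n π ∣ Polynomial.X ^ N * H₂ := by
  obtain ⟨Z, hZ⟩ := h
  obtain ⟨a, Z', ha⟩ := exists_X_pow_mul_eq_radialExtend n Z
  obtain ⟨b, H₁', hb⟩ := exists_X_pow_mul_eq_radialExtend n H₁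
  obtain ⟨c, H₂', hc⟩ := exists_X_pow_mul_eq_radialExtend n H₂
  have key : Polynomial.C π * (Polynomial.X ^ (b + c) * Z') = Polynomial.X ^ a * (H₁' * H₂') := by
    apply radialExtend_injective n
    simp only [map_mul, map_pow, radialExtend_X, radialExtend_C, ← ha, ← hb, ← hc]
    linear_combination (-Polynomial.X ^ (a + b + c)) * hZ
  have hC : Prime (Polynomial.C π) := Polynomial.prime_C_iff.mpr hπ
  have dvd {M : ℕ} {H H' : Polynomial (MvPolynomial σ R)}
      (e : Polynomial.X ^ M * H = radialExtend n H') (d : Polynomial.C π ∣ H') :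
      radial n π ∣ Polynomial.X ^ M * H := by
    rw [e, ← radialExtend_C]
    exact map_dvd _ d
  rcases hC.dvd_or_dvd (Dvd.intro _ key) with h | h
  · have := (Polynomial.C_dvd_iff_dvd_coeff _ _).mp h a
    rw [Polynomial.coeff_X_pow_self] at this
    exact absurd (isUnit_of_dvd_one this) hπ.not_isUnit
  · rcases hC.dvd_or_dvd h with h | h
    · exact ⟨b, Or.inl (dvd hb h)⟩
    · exact ⟨c, Or.inr (dvd hc h)⟩

lemma dvd_of_radial_dvd_X_pow_mul {π g : MvPolynomial σ R} (n : σ → R) {N : ℕ}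
    (h : radial n π ∣ Polynomial.X ^ N * radial n g) : π ∣ g := by
  obtain ⟨Z, hZ⟩ := h
  obtain ⟨a, Z', ha⟩ := exists_X_pow_mul_eq_radialExtend n Z
  have key : Polynomial.C π * Z' = Polynomial.C g * Polynomial.X ^ (N + a) := by
    apply radialExtend_injective n
    simp only [map_mul, map_pow, radialExtend_X, radialExtend_C, ← ha]
    linear_combination (-Polynomial.X ^ a) * hZ
  have := (Polynomial.C_dvd_iff_dvd_coeff _ _).mp (Dvd.intro _ key) (N + a)
  simpa [Polynomial.coeff_C_mul, Polynomial.coeff_X_pow_self] using this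

lemma exists_C_mul_X_pow_eq_of_prime {π g : MvPolynomial σ R} (hπ : Prime π) (hg : ¬ π ∣ g)
    (n : σ → R) :
    ∃ (c : MvPolynomial σ R) (N : ℕ) (a b : Polynomial (MvPolynomial σ R)), c ≠ 0 ∧
      Polynomial.C c * Polynomial.X ^ N = a * radial n π + b * radial n g := by
  obtain ⟨D, F', G', a, b, c, hc, hF, hG, hD⟩ := exists_pseudo_gcd (radial n π) (radial n g)
  have hπ0 : radial n π ≠ 0 := by
    rw [← radialExtend_C, map_ne_zero_iff _ (radialExtend_injective n)]
    simpa using hπ.ne_zero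
  obtain ⟨N, ⟨Z, hZ⟩ | ⟨Z, hZ⟩⟩ := radial_dvd_X_pow_mul_of_dvd_mul hπ n
    (Dvd.intro_left _ hF : radial n π ∣ D * F')
  · have : radial n π ∣ Polynomial.C c * (Polynomial.X ^ N * radial n g) :=
      ⟨Z * G', by linear_combination Polynomial.X ^ N * hG + G' * hZ⟩
    obtain ⟨M, ⟨W, hW⟩ | h⟩ := radial_dvd_X_pow_mul_of_dvd_mul hπ n this
    · exact ⟨c, M, W, 0, hc, by linear_combination hW⟩
    · rw [← mul_assoc, ← pow_add] at h
      exact absurd (dvd_of_radial_dvd_X_pow_mul n h) hg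
  · have : Polynomial.C c * Polynomial.X ^ N = D * Z := by
      apply mul_left_cancel₀ hπ0
      linear_combination Polynomial.X ^ N * hF + D * hZ
    refine ⟨c * c, N, Z * a, Z * b, mul_ne_zero hc hc, ?_⟩
    rw [Polynomial.C_mul]
    linear_combination Polynomial.C c * this + Z * hD

variable [UniqueFactorizationMonoid R]

lemma exists_C_mul_X_pow_mem_span_radial {ι : Type*} (n : σ → R) (P : ι → MvPolynomial σ R)
    (f : MvPolynomial σ R) (hf : f ≠ 0)
    (h : ∀ π, Prime π → π ∣ f → ∃ i, ¬ π ∣ P i) :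
    ∃ (c : MvPolynomial σ R) (N : ℕ) (a : Polynomial (MvPolynomial σ R)), c ≠ 0 ∧
      Polynomial.C c * Polynomial.X ^ N - a * radial n f ∈
        Ideal.span (Set.range fun i => radial n (P i)) := by
  induction f using UniqueFactorizationMonoid.induction_on_prime with
  | h₁ => exact absurd rfl hf
  | h₂ u hu =>
    obtain ⟨v, hv⟩ := hu.exists_left_inv
    refine ⟨1, 0, radial n v, one_ne_zero, ?_⟩
    rw [← map_mul, hv]
    simp
  | h₃ f π hf0 hπ ih =>
    obtain ⟨c, N, a, hc, ha⟩ := ih hf0 fun p hp hpf => h p hp (hpf.mul_left π)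
    obtain ⟨i, hi⟩ := h π hπ (dvd_mul_right π f)
    obtain ⟨d, M, u, v, hd, huv⟩ := exists_C_mul_X_pow_eq_of_prime hπ hi n
    refine ⟨c * d, N + M, a * u, mul_ne_zero hc hd, ?_⟩
    have hPi : radial n (P i) ∈ Ideal.span (Set.range fun i => radial n (P i)) :=
      Ideal.subset_span ⟨i, rfl⟩
    have := add_mem (Ideal.mul_mem_left _ (Polynomial.C d * Polynomial.X ^ M) ha)
      (Ideal.mul_mem_left _ (a * radial n f * v) hPi)
    convert this using 1
    rw [Polynomial.C_mul, map_mul]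
    linear_combination (a * radial n f) * huv

end Radial

section Line

lemma eval_map_eval_radial {σ R : Type*} [CommRing R] (n y : σ → R) (t : R)
    (f : MvPolynomial σ R) :
    ((radial n f).map (eval y)).eval t = eval (fun i => n i + t * y i) f := by
  induction f using MvPolynomial.induction_on with
  | C r => simp [radial]
  | add p q hp hq => simp only [map_add, Polynomial.map_add, Polynomial.eval_add, hp, hq]
  | mul_X p i hp =>
    rw [map_mul, Polynomial.map_mul, Polynomial.eval_mul, hp]
    simp [radial, mul_comm t]

variable {r s : ℕ}

lemma exists_eval_lattice_ne_zero {c : MvPolynomial (Fin r) ℚ} (hc : c ≠ 0) (u : Fin r → ℤ)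
    {M : ℤ} (hM : M ≠ 0) :
    ∃ z : Fin r → ℤ, eval (fun i => ((u i + M * z i : ℤ) : ℚ)) c ≠ 0 := by
  by_contra! h
  refine hc (funext_set (fun i => Set.range fun z : ℤ => ((u i + M * z : ℤ) : ℚ))
    (fun i => Set.infinite_range_of_injective fun z w hzw => ?_) fun x hx => ?_)
  · simpa [hM] using hzw
  · choose z hz using fun i => hx i trivial
    rw [map_zero, ← h z]
    exact congrArg (fun x => eval x c) (funext fun i => (hz i).symm)

lemma one_mem_span_of_C_mul_X_pow_mem {ι : Type*} [Fintype ι] (Q : ι → Polynomial ℚ)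
    {c : ℚ} (hc : c ≠ 0) {N : ℕ}
    (hN : Polynomial.C c * Polynomial.X ^ N ∈ Ideal.span (Set.range Q))
    (h0 : ∃ i, (Q i).eval 0 ≠ 0) : (1 : Polynomial ℚ) ∈ Ideal.span (Set.range Q) := by
  obtain ⟨i, hi⟩ := h0
  have hX : (Polynomial.X : Polynomial ℚ) ^ N ∈ Ideal.span (Set.range Q) := by
    have := Ideal.mul_mem_left _ (Polynomial.C c⁻¹) hN
    rwa [← mul_assoc, ← Polynomial.C_mul, inv_mul_cancel₀ hc, Polynomial.C_1, one_mul] at this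
  have hcop : IsCoprime (Polynomial.X : Polynomial ℚ) (Q i) := by
    refine (Polynomial.irreducible_X.coprime_iff_not_dvd).mpr fun h => hi ?_
    rwa [Polynomial.X_dvd_iff, Polynomial.coeff_zero_eq_eval_zero] at h
  obtain ⟨a, b, hab⟩ := hcop.pow_left (m := N)
  rw [← hab]
  exact add_mem (Ideal.mul_mem_left _ _ hX) (Ideal.mul_mem_left _ _ (Ideal.subset_span ⟨i, rfl⟩))

lemma exists_line_bound (P : Fin s → MvPolynomial (Fin r) ℤ) (hP : ∀ i, P i ≠ 0)
    (hcop : ∀ D : MvPolynomial (Fin r) ℚ,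
      (∀ i, D ∣ (P i).map (Int.castRingHom ℚ)) → D.totalDegree = 0)
    (n m : Fin r → ℤ) (hn : ∃ i, eval n (P i) ≠ 0) {M : ℤ} (hM : M ≠ 0) :
    ∃ (q : Fin r → ℤ) (δ : ℤ), δ ≠ 0 ∧ (∀ j, M ∣ q j - m j) ∧
      ∀ t d : ℤ, (∀ i, d ∣ eval (fun j => n j + t * (q j - n j)) (P i)) → d ∣ δ := by
  obtain ⟨i₀, hi₀⟩ := hn
  have cast_eval (x : Fin r → ℤ) (f : MvPolynomial (Fin r) ℤ) :
      eval (fun j => (x j : ℚ)) (f.map (Int.castRingHom ℚ)) = (eval x f : ℤ) := by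
    rw [eval_map]
    exact (eval₂_comp (Int.castRingHom ℚ) x f).symm
  let nQ : Fin r → ℚ := fun j => n j
  let PQ : Fin s → MvPolynomial (Fin r) ℚ := fun i => (P i).map (Int.castRingHom ℚ)
  have hPQ : PQ i₀ ≠ 0 :=
    (map_ne_zero_iff _ (map_injective _ (Int.castRingHom ℚ).injective_int)).mpr (hP i₀)
  obtain ⟨c, N, a, hc, ha⟩ := exists_C_mul_X_pow_mem_span_radial nQ PQ (PQ i₀) hPQ
    fun π hπ _ => by
      by_contra! h
      have := totalDegree_eq_zero_iff_eq_C.mp (hcop π h)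
      refine hπ.not_isUnit ?_
      rw [this]
      refine IsUnit.map C (IsUnit.mk0 _ fun h0 => hπ.ne_zero ?_)
      rw [this, h0, map_zero]
  have hmem : Polynomial.C c * Polynomial.X ^ N ∈
      Ideal.span (Set.range fun i => radial nQ (PQ i)) := by
    have := add_mem ha (Ideal.mul_mem_left _ a (Ideal.subset_span ⟨i₀, rfl⟩))
    simpa using this
  obtain ⟨z, hz⟩ := exists_eval_lattice_ne_zero hc (fun j => m j - n j) hM
  set y : Fin r → ℤ := fun j => m j - n j + M * z j with hy
  let yQ : Fin r → ℚ := fun j => y j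
  let Q : Fin s → Polynomial ℚ := fun i => (radial nQ (PQ i)).map (eval yQ)
  have hQ (t : ℤ) (i) : (Q i).eval (t : ℚ) = (eval (fun j => n j + t * y j) (P i) : ℤ) := by
    rw [eval_map_eval_radial, ← cast_eval]
    simp [nQ, yQ, PQ]
  have hmem' : Polynomial.C (eval yQ c) * Polynomial.X ^ N ∈ Ideal.span (Set.range Q) := by
    have := Ideal.mem_map_of_mem (Polynomial.mapRingHom (eval yQ)) hmem
    rw [Ideal.map_span, ← Set.range_comp] at this
    simpa [Function.comp_def, Q] using this
  have h1 := one_mem_span_of_C_mul_X_pow_mem Q hz hmem' ⟨i₀, by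
    have := hQ 0 i₀
    simp only [Int.cast_zero, zero_mul, add_zero] at this
    rw [this]
    exact_mod_cast hi₀⟩
  obtain ⟨b, hb⟩ := Ideal.mem_span_range_iff_exists_fun.mp h1
  obtain ⟨δ, hδ, h, hh⟩ := exists_map_eq_C_mul (A := ℤ) b
  refine ⟨fun j => n j + y j, δ, hδ, fun j => ⟨z j, by simp only [hy]; ring⟩, fun t d hd => ?_⟩
  have key : δ = ∑ i, (h i).eval t * eval (fun j => n j + t * y j) (P i) := by
    have e := congrArg (fun p => (δ : ℚ) * Polynomial.eval (t : ℚ) p) hb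
    have hi (i) : (((h i).eval t : ℤ) : ℚ) = δ * (b i).eval (t : ℚ) := by
      have := congrArg (Polynomial.eval (t : ℚ)) (hh i)
      rw [Polynomial.eval_mul, Polynomial.eval_C] at this
      rw [← eq_intCast (algebraMap ℤ ℚ) δ, ← this, Polynomial.eval_intCast_map]
      simp
    simp only [Polynomial.eval_finsetSum, Polynomial.eval_mul, hQ, Polynomial.eval_one,
      Finset.mul_sum] at e
    have : (δ : ℚ) = ∑ i, (((h i).eval t : ℤ) : ℚ) *
        ((eval (fun j => n j + t * y j) (P i) : ℤ) : ℚ) := by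
      simp only [hi]
      rw [mul_one] at e
      exact e.symm.trans (Finset.sum_congr rfl fun i _ => (mul_assoc _ _ _).symm)
    exact_mod_cast this
  rw [key]
  refine Finset.dvd_sum fun i _ => Dvd.dvd.mul_left ?_ _
  simpa using hd i

end Line

section Arithmetic

lemma dvd_eval_sub_eval {σ R : Type*} [CommRing R] {M : R} {x y : σ → R}
    (h : ∀ j, M ∣ x j - y j) (f : MvPolynomial σ R) : M ∣ eval x f - eval y f := by
  induction f using MvPolynomial.induction_on with
  | C r => simp
  | add p q hp hq => simpa [add_sub_add_comm] using dvd_add hp hq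
  | mul_X p i hp =>
    simp only [map_mul, eval_X]
    exact dvd_mul_sub_mul hp (h i)

lemma factorization_eq_of_pow_dvd_iff {x y p e : ℕ} (hp : p.Prime) (hx : x ≠ 0) (hy : y ≠ 0)
    (h : ∀ k ≤ e, p ^ k ∣ x ↔ p ^ k ∣ y) (he : ¬ p ^ e ∣ y) :
    x.factorization p = y.factorization p := by
  simp only [hp.pow_dvd_iff_le_factorization hx, hp.pow_dvd_iff_le_factorization hy] at h he
  have h1 := h e le_rfl
  have h2 := h (x.factorization p)
  have h3 := h (y.factorization p)
  omega

variable {σ ι : Type*} [Fintype ι]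

/-- The nonnegative gcd of the values of the polynomials `P i` at `n`. -/
noncomputable def valueGcd (P : ι → MvPolynomial σ ℤ) (n : σ → ℤ) : ℕ :=
  (Finset.univ.gcd fun i => eval n (P i)).natAbs

lemma coe_valueGcd (P : ι → MvPolynomial σ ℤ) (n : σ → ℤ) :
    (valueGcd P n : ℤ) = Finset.univ.gcd fun i => eval n (P i) := by
  rw [valueGcd, Int.natCast_natAbs, Int.abs_eq_normalize, Finset.normalize_gcd]

lemma dvd_valueGcd_iff (P : ι → MvPolynomial σ ℤ) (n : σ → ℤ) (d : ℕ) :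
    d ∣ valueGcd P n ↔ ∀ i, (d : ℤ) ∣ eval n (P i) := by
  rw [← Int.natCast_dvd_natCast, coe_valueGcd, Finset.dvd_gcd_iff]
  simp

lemma dvd_valueGcd_congr (P : ι → MvPolynomial σ ℤ) {x y : σ → ℤ} {d : ℕ}
    (h : ∀ j, (d : ℤ) ∣ x j - y j) : d ∣ valueGcd P x ↔ d ∣ valueGcd P y := by
  simp only [dvd_valueGcd_iff]
  exact forall_congr' fun i => dvd_iff_dvd_of_dvd_sub (dvd_eval_sub_eval h (P i))

lemma factorization_valueGcd_congr (P : ι → MvPolynomial σ ℤ) {x y : σ → ℤ} {p e : ℕ}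
    (hp : p.Prime) (hx : valueGcd P x ≠ 0) (hy : valueGcd P y ≠ 0)
    (he : ¬ p ^ e ∣ valueGcd P y) (h : ∀ j, ((p ^ e : ℕ) : ℤ) ∣ x j - y j) :
    (valueGcd P x).factorization p = (valueGcd P y).factorization p :=
  factorization_eq_of_pow_dvd_iff hp hx hy (fun _ hk => dvd_valueGcd_congr P fun j =>
    (Int.natCast_dvd_natCast.mpr (pow_dvd_pow p hk)).trans (h j)) he

lemma exists_modEq_prime_pow (τ e : ℕ → ℕ) (S : Finset ℕ) (hS : ∀ p ∈ S, p.Prime) :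
    ∃ t : ℕ, ∀ p ∈ S, t ≡ τ p [MOD p ^ e p] := by
  obtain ⟨t, ht⟩ := Nat.chineseRemainderOfFinset τ (fun p => p ^ e p) S
    (fun p hp => pow_ne_zero _ (hS p hp).ne_zero) fun p hp q hq hpq =>
      Nat.Coprime.pow _ _ ((Nat.coprime_primes (hS p hp) (hS q hq)).mpr hpq)
  exact ⟨t, ht⟩

end Arithmetic

lemma exists_valueGcd_eq {s r : ℕ} (P : Fin s → MvPolynomial (Fin r) ℤ) (hP : ∀ i, P i ≠ 0)
    (hcop : ∀ D : MvPolynomial (Fin r) ℚ,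
      (∀ i, D ∣ (P i).map (Int.castRingHom ℚ)) → D.totalDegree = 0)
    {n m : Fin r → ℤ} (hn : valueGcd P n ≠ 0) (hm : valueGcd P m ≠ 0) {T : ℕ} (hT : T ≠ 0)
    (hTp : ∀ p, T.factorization p = (valueGcd P n).factorization p ∨
      T.factorization p = (valueGcd P m).factorization p) :
    ∃ x, valueGcd P x = T := by
  set a := valueGcd P n with ha
  set b := valueGcd P m with hb
  have hn' : ∃ i, eval n (P i) ≠ 0 := by
    by_contra! h
    exact hn (zero_dvd_iff.mp ((dvd_valueGcd_iff P n 0).mpr (by simp [h])))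
  have hM : ((a * b * b : ℕ) : ℤ) ≠ 0 := by positivity
  obtain ⟨q, δ', hδ', hq, hline⟩ := exists_line_bound P hP hcop n m hn' hM
  obtain ⟨δ, hδ, hline⟩ : ∃ δ : ℕ, δ ≠ 0 ∧
      ∀ t : ℤ, valueGcd P (fun j => n j + t * (q j - n j)) ∣ δ :=
    ⟨δ'.natAbs, by simpa using hδ', fun t => Int.natCast_dvd.mp
      (hline t _ ((dvd_valueGcd_iff P _ _).mp dvd_rfl))⟩
  have hnδ : a ∣ δ := by simpa using hline 0
  have hqδ : valueGcd P q ∣ δ := by simpa using hline 1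
  have hq0 : valueGcd P q ≠ 0 := ne_zero_of_dvd_ne_zero hδ hqδ
  have not_dvd {p d : ℕ} (hp : p.Prime) (hd : d ≠ 0) (hdδ : d ∣ δ) :
      ¬ p ^ (δ.factorization p + 1) ∣ d := fun h =>
    Nat.pow_succ_factorization_not_dvd hδ hp (h.trans hdδ)
  have hqb {p : ℕ} (hp : p.Prime) (hpab : p ∣ a * b) :
      (valueGcd P q).factorization p = b.factorization p := by
    refine factorization_valueGcd_congr P (e := b.factorization p + 1) hp hq0 hm
      (Nat.pow_succ_factorization_not_dvd hm hp) fun j => ?_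
    refine (Int.natCast_dvd_natCast.mpr ?_).trans (hq j)
    rw [pow_succ, mul_comm]
    exact mul_dvd_mul hpab (Nat.ordProj_dvd b p)
  classical
  obtain ⟨t, ht⟩ := exists_modEq_prime_pow
    (fun p => if p ∣ a * b ∧ T.factorization p = b.factorization p then 1 else 0)
    (fun p => δ.factorization p + 1) (δ * b).primeFactors fun p => Nat.prime_of_mem_primeFactors
  let x : Fin r → ℤ := fun j => n j + (t : ℤ) * (q j - n j)
  have hxδ : valueGcd P x ∣ δ := hline t
  have hx0 : valueGcd P x ≠ 0 := ne_zero_of_dvd_ne_zero hδ hxδ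
  refine ⟨x, Nat.eq_of_factorization_eq hx0 hT fun p => ?_⟩
  by_cases hp : p.Prime
  swap
  · simp [hp]
  have of_not_dvd {d : ℕ} (h : ¬ p ∣ d) : d.factorization p = 0 :=
    Nat.factorization_eq_zero_of_not_dvd h
  by_cases hpδ : p ∣ δ * b
  · have ht := ht p (Nat.mem_primeFactors.mpr ⟨hp, hpδ, mul_ne_zero hδ hm⟩)
    have ht := Nat.modEq_iff_dvd.mp ht.symm
    split_ifs at ht with h
    · rw [h.2, ← hqb hp h.1]
      refine factorization_valueGcd_congr P hp hx0 hq0 (not_dvd hp hq0 hqδ) fun j => ?_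
      have : x j - q j = ((t : ℤ) - (1 : ℕ)) * (q j - n j) := by
        simp only [x, Nat.cast_one]; ring
      rw [this]
      exact ht.mul_right _
    · have hTa : T.factorization p = a.factorization p := by
        by_cases hab : p ∣ a * b
        · exact (hTp p).resolve_right fun h' => h ⟨hab, h'⟩
        · have h1 := of_not_dvd fun h => hab (h.mul_right b)
          have h2 := of_not_dvd fun h => hab (h.mul_left a)
          have := hTp p
          omega
      rw [hTa]
      refine factorization_valueGcd_congr P hp hx0 hn (not_dvd hp hn hnδ) fun j => ?_
      have : x j - n j = ((t : ℤ) - (0 : ℕ)) * (q j - n j) := by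
        simp only [x, Nat.cast_zero]; ring
      rw [this]
      exact ht.mul_right _
  · have h1 := of_not_dvd fun h => hpδ ((h.trans hxδ).mul_right b)
    have h2 := of_not_dvd fun h => hpδ ((h.trans hnδ).mul_right b)
    have h3 := of_not_dvd fun h => hpδ (h.mul_left δ)
    have := hTp p
    omega

/-- The set 𝒟 of gcds of values of nonzero coprime polynomials is stable
under gcd and lcm. -/
theorem stmt0 (s r : ℕ) (hs : 2 ≤ s) (hr : 1 ≤ r)
    (P : Fin s → MvPolynomial (Fin r) ℤ)
    (hP : ∀ i, P i ≠ 0)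
    (hcop : ∀ D : MvPolynomial (Fin r) ℚ,
      (∀ i, D ∣ (P i).map (Int.castRingHom ℚ)) → D.totalDegree = 0) :
    ∀ n m : Fin r → ℤ,
      (∃ n' : Fin r → ℤ,
        gcd (Finset.univ.gcd fun i => eval n (P i))
            (Finset.univ.gcd fun i => eval m (P i))
          = Finset.univ.gcd fun i => eval n' (P i)) ∧
      (∃ n'' : Fin r → ℤ,
        lcm (Finset.univ.gcd fun i => eval n (P i))
            (Finset.univ.gcd fun i => eval m (P i))
          = Finset.univ.gcd fun i => eval n'' (P i)) := by
  intro n m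
  simp only [← coe_valueGcd, ← Int.coe_gcd, ← Int.coe_lcm, Int.gcd_natCast_natCast,
    Int.lcm_natCast_natCast, Nat.cast_inj]
  rcases eq_or_ne (valueGcd P n) 0 with hn | hn
  · exact ⟨⟨m, by simp [hn]⟩, n, by simp [hn]⟩
  rcases eq_or_ne (valueGcd P m) 0 with hm | hm
  · exact ⟨⟨n, by simp [hm]⟩, m, by simp [hm]⟩
  obtain ⟨x, hx⟩ := exists_valueGcd_eq P hP hcop hn hm (Nat.gcd_ne_zero_left hn) fun p => by
    rw [Nat.factorization_gcd hn hm]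
    exact min_choice _ _
  obtain ⟨y, hy⟩ := exists_valueGcd_eq P hP hcop hn hm (Nat.lcm_ne_zero hn hm) fun p => by
    rw [Nat.factorization_lcm hn hm]
    exact max_choice _ _
  exact ⟨⟨x, hx.symm⟩, y, hy.symm⟩
end

section
/- Let P_1,…,P_s ∈ ℤ[x_1,…,x_r] (s ≥ 2, r ≥ 1) be nonzero coprime polynomials. Suppose there is no prime p dividing P_i(n) for every i = 1,…,s and every n ∈ ℤ^r. Then there exists n_0 ∈ ℤ^r such that the integers P_1(n_0),…,P_s(n_0) are coprime, i.e., gcd(P_1(n_0),…,P_s(n_0)) = 1. -/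
open MvPolynomial

/-- A set of polynomials over a UFD without a common factor of positive degree generates an ideal
containing a nonzero constant. -/
theorem Polynomial.exists_C_mem_span_of_forall_dvd_natDegree_eq_zero {R : Type*} [CommRing R]
    [IsDomain R] [UniqueFactorizationMonoid R] (T : Set (Polynomial R))
    (hT : ∀ D : Polynomial R, (∀ P ∈ T, D ∣ P) → D.natDegree = 0) :
    ∃ e : R, e ≠ 0 ∧ Polynomial.C e ∈ Ideal.span T := by
  classical
  let : NormalizedGCDMonoid R := Classical.arbitrary _
  let K := FractionRing R
  let := Polynomial.algebra R K
  have := Polynomial.isLocalization (nonZeroDivisors R) K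
  suffices h : Ideal.map (algebraMap (Polynomial R) (Polynomial K)) (Ideal.span T) = ⊤ by
    have h2 := mt (IsLocalization.map_algebraMap_ne_top_iff_disjoint
      ((nonZeroDivisors R).map Polynomial.C) (Polynomial K) (Ideal.span T)).2 (not_not.2 h)
    obtain ⟨_, ⟨e, he, rfl⟩, h3⟩ := Set.not_disjoint_iff.1 h2
    exact ⟨e, nonZeroDivisors.ne_zero he, h3⟩
  set J := Ideal.map (algebraMap (Polynomial R) (Polynomial K)) (Ideal.span T)
  obtain ⟨G, hG⟩ := (IsPrincipalIdealRing.principal J).principal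
  rw [Ideal.submodule_span_eq] at hG
  have hdvd : ∀ P ∈ T, G ∣ P.map (algebraMap R K) := fun P hP => by
    rw [← Ideal.mem_span_singleton, ← hG]
    exact Ideal.mem_map_of_mem _ (Ideal.subset_span hP)
  have hinj : Function.Injective (algebraMap R K) := IsFractionRing.injective R K
  have hG0 : G ≠ 0 := by
    rintro rfl
    have h0 : ∀ P ∈ T, P = 0 := fun P hP =>
      (Polynomial.map_eq_zero_iff hinj).1 (zero_dvd_iff.1 (hdvd P hP))
    have := hT Polynomial.X fun P hP => by simp [h0 P hP]
    simp at this
  obtain ⟨b, hb, hbG⟩ := IsLocalization.integerNormalization_spec (nonZeroDivisors R) G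
  set G₀ := IsLocalization.integerNormalization (nonZeroDivisors R) G
  have hb0 : algebraMap R K b ≠ 0 := by
    simpa using (map_ne_zero_iff _ hinj).2 (nonZeroDivisors.ne_zero hb)
  have hbG' : G₀.map (algebraMap R K) = Polynomial.C (algebraMap R K b) * G := by
    rw [hbG, ← algebraMap_smul K b G, Polynomial.smul_eq_C_mul]
  have hdvd' : ∀ P ∈ T, G₀.primPart ∣ P := fun P hP => by
    refine G₀.isPrimitive_primPart.dvd_of_fraction_map_dvd_fraction_map (K := K) ?_
    refine (Polynomial.map_dvd _ G₀.primPart_dvd).trans ?_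
    rw [hbG', (Polynomial.isUnit_C.2 hb0.isUnit).mul_left_dvd]
    exact hdvd P hP
  have hdeg := hT _ hdvd'
  rw [Polynomial.natDegree_primPart, ← Polynomial.natDegree_map_eq_of_injective hinj, hbG',
    Polynomial.natDegree_C_mul hb0] at hdeg
  rw [hG, Ideal.span_singleton_eq_top]
  rw [Polynomial.eq_C_of_natDegree_eq_zero hdeg, Polynomial.isUnit_C]
  refine IsUnit.mk0 _ fun h => hG0 ?_
  rw [Polynomial.eq_C_of_natDegree_eq_zero hdeg, h, map_zero]

/-- An integer polynomial of degree less than a prime `p`, not all of whose coefficients are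
divisible by `p`, takes a value prime to `p`. -/
theorem Polynomial.exists_not_dvd_eval_of_natDegree_lt {p : ℕ} (hp : p.Prime)
    (f : Polynomial ℤ) (hf : f.natDegree < p) (k : ℕ) (hk : ¬ (p : ℤ) ∣ f.coeff k) :
    ∃ b : ℤ, ¬ (p : ℤ) ∣ f.eval b := by
  have := Fact.mk hp
  have hne : f.map (Int.castRingHom (ZMod p)) ≠ 0 := fun h => hk <| by
    rw [← ZMod.intCast_zmod_eq_zero_iff_dvd]
    simpa using congrArg (fun g => Polynomial.coeff g k) h
  obtain ⟨r, hr⟩ := Polynomial.exists_eval_ne_zero_of_natDegree_lt_card _ hne (by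
    rw [Cardinal.mk_fintype, ZMod.card]
    exact_mod_cast Polynomial.natDegree_map_le.trans_lt hf)
  obtain ⟨b, rfl⟩ := ZMod.intCast_surjective r
  refine ⟨b, fun h => hr ?_⟩
  rw [← ZMod.intCast_zmod_eq_zero_iff_dvd] at h
  simpa [Polynomial.eval_intCast_map] using h

/-- The Chinese remainder theorem for a modulus and finitely many primes not dividing it. -/
theorem Int.exists_congr_of_forall_prime_not_dvd (N b : ℤ) (x : ℕ → ℤ) (Q : Finset ℕ)
    (hQ : ∀ p ∈ Q, p.Prime ∧ ¬ (p : ℤ) ∣ N) :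
    ∃ y : ℤ, N ∣ y - b ∧ ∀ p ∈ Q, (p : ℤ) ∣ y - x p := by
  classical
  induction Q using Finset.induction_on with
  | empty => exact ⟨b, by simp⟩
  | insert q Q hq ih =>
    obtain ⟨y, hyN, hyQ⟩ := ih fun p hp => hQ p (Finset.mem_insert_of_mem hp)
    obtain ⟨hqp, hqN⟩ := hQ q (Finset.mem_insert_self _ _)
    have hcop : IsCoprime (q : ℤ) (N * ∏ p ∈ Q, (p : ℤ)) := by
      refine IsCoprime.mul_right ?_ (IsCoprime.prod_right fun p hp => ?_)
      · exact (Prime.coprime_iff_not_dvd (Nat.prime_iff_prime_int.1 hqp)).2 hqN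
      · refine Nat.isCoprime_iff_coprime.2 ((Nat.coprime_primes hqp
          (hQ p (Finset.mem_insert_of_mem hp)).1).2 ?_)
        rintro rfl
        exact hq hp
    obtain ⟨u, v, huv⟩ := hcop
    refine ⟨y + v * (N * ∏ p ∈ Q, (p : ℤ)) * (x q - y), ?_, fun p hp => ?_⟩
    · rw [add_sub_right_comm]
      exact dvd_add hyN (((dvd_mul_right _ _).mul_left _).mul_right _)
    · rcases Finset.mem_insert.1 hp with rfl | hp
      · exact ⟨u * (y - x p), by linear_combination (x p - y) * huv⟩
      · rw [add_sub_right_comm]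
        exact dvd_add (hyQ p hp)
          ((((Finset.dvd_prod_of_mem (fun p : ℕ => (p : ℤ)) hp).mul_left _).mul_left _).mul_right _)

/-- A nonzero integer polynomial does not vanish identically on an arithmetic progression. -/
theorem Polynomial.exists_dvd_sub_eval_ne_zero {M : ℤ} (hM : M ≠ 0) (y₀ : ℤ)
    {f : Polynomial ℤ} (hf : f ≠ 0) : ∃ y : ℤ, M ∣ y - y₀ ∧ f.eval y ≠ 0 := by
  by_contra! h
  refine hf (f.eq_zero_of_infinite_isRoot ?_)
  refine (Set.infinite_range_of_injective (f := fun k : ℤ => y₀ + M * k) ?_).mono ?_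
  · intro a b hab
    simpa [hM] using hab
  · rintro _ ⟨k, rfl⟩
    exact h _ (by simp)

theorem MvPolynomial.dvd_eval_sub_eval {r : ℕ} (P : MvPolynomial (Fin r) ℤ) {p : ℤ}
    {n m : Fin r → ℤ} (h : ∀ i, p ∣ n i - m i) : p ∣ eval n P - eval m P := by
  induction P using MvPolynomial.induction_on with
  | C a => simp
  | add f g hf hg =>
    rw [map_add, map_add, add_sub_add_comm]
    exact dvd_add hf hg
  | mul_X f i hf =>
    rw [map_mul, map_mul, eval_X, eval_X]
    have : eval n f * n i - eval m f * m i =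
      (eval n f - eval m f) * n i + eval m f * (n i - m i) := by ring
    rw [this]
    exact dvd_add (hf.mul_right _) ((h i).mul_left _)

/-- For coprime polynomials there is an `N₀ ≠ 0` such that every residue class modulo a nonzero
multiple `N` of `N₀` contains a point, outside a given hypersurface, at which the values of
the polynomials have no common prime divisor that does not divide `N`. -/
theorem MvPolynomial.exists_congr_forall_prime_dvd (r : ℕ) :
    ∀ S : Finset (MvPolynomial (Fin r) ℤ),
      (∀ D, (∀ P ∈ S, D ∣ P) → ∃ c : ℤ, c ≠ 0 ∧ D = C c) →
      ∃ N₀ : ℤ, N₀ ≠ 0 ∧ ∀ N : ℤ, N ≠ 0 → N₀ ∣ N →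
        ∀ (a : Fin r → ℤ) (δ : MvPolynomial (Fin r) ℤ), δ ≠ 0 →
        ∃ n : Fin r → ℤ, (∀ i, N ∣ n i - a i) ∧ eval n δ ≠ 0 ∧
          ∀ p : ℕ, p.Prime → (∀ P ∈ S, (p : ℤ) ∣ eval n P) → (p : ℤ) ∣ N := by
  classical
  induction r with
  | zero =>
    intro S hS
    have hne : ∃ P ∈ S, P ≠ 0 := by
      by_contra! h
      obtain ⟨c, hc, h0⟩ := hS 0 fun P hP => by rw [h P hP]
      exact hc (C_injective _ _ (by rw [← h0, map_zero]))
    have key : ∀ (P : MvPolynomial (Fin 0) ℤ) (n : Fin 0 → ℤ), P ≠ 0 → eval n P ≠ 0 := by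
      intro P n hP h
      rw [eq_C_of_isEmpty P, eval_C] at h
      exact hP (by rw [eq_C_of_isEmpty P, h, map_zero])
    obtain ⟨P, hPS, hP⟩ := hne
    refine ⟨eval 0 P, key P 0 hP, fun N _ hdvd a δ hδ => ⟨a, by simp, key δ a hδ, fun p _ h => ?_⟩⟩
    rw [Subsingleton.elim a 0] at h
    exact (h P hPS).trans hdvd
  | succ r ih =>
    intro S hS
    let φ := finSuccEquiv ℤ r
    have hφC : ∀ c : ℤ, φ (C c) = Polynomial.C (C c) := fun c => by
      simp [φ]
    obtain ⟨N₀, hN₀, hN⟩ := ih (S.biUnion fun P => (φ P).coeffs) (by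
      intro D hD
      obtain ⟨c, hc, h⟩ := hS (φ.symm (Polynomial.C D)) fun P hP => by
        rw [← map_dvd_iff φ, AlgEquiv.apply_symm_apply, Polynomial.C_dvd_iff_dvd_coeff]
        intro i
        by_cases hi : (φ P).coeff i = 0
        · simp [hi]
        · exact hD _ (Finset.mem_biUnion.2 ⟨P, hP, Polynomial.coeff_mem_coeffs hi⟩)
      refine ⟨c, hc, Polynomial.C_injective ?_⟩
      rw [← hφC, ← h, AlgEquiv.apply_symm_apply])
    obtain ⟨ε, hε, hεS⟩ := Polynomial.exists_C_mem_span_of_forall_dvd_natDegree_eq_zero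
      (φ '' (S : Set (MvPolynomial (Fin (r + 1)) ℤ))) (by
      intro D hD
      obtain ⟨c, -, h⟩ := hS (φ.symm D) fun P hP => by
        rw [← map_dvd_iff φ, AlgEquiv.apply_symm_apply]
        exact hD _ ⟨P, hP, rfl⟩
      rw [← φ.apply_symm_apply D, h, hφC, Polynomial.natDegree_C])
    let d := S.sup fun P => (φ P).natDegree
    refine ⟨N₀ * d.factorial, mul_ne_zero hN₀ (by exact_mod_cast d.factorial_ne_zero), ?_⟩
    intro N hN0 hdvd a δ hδ
    have hφδ : φ δ ≠ 0 := (map_ne_zero_iff _ φ.injective).2 hδ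
    obtain ⟨x, hxa, hx0, hx⟩ := hN N hN0 (dvd_of_mul_right_dvd hdvd) (Fin.tail a)
      (ε * (φ δ).leadingCoeff) (mul_ne_zero hε (Polynomial.leadingCoeff_ne_zero.2 hφδ))
    rw [map_mul] at hx0
    have he : eval x ε ≠ 0 := left_ne_zero_of_mul hx0
    have hδx : (φ δ).map (eval x) ≠ 0 := fun h => right_ne_zero_of_mul hx0 <| by
      simpa using congrArg (fun g => Polynomial.coeff g (φ δ).natDegree) h
    let Q := (eval x ε).natAbs.primeFactors.filter fun p : ℕ => ¬ (p : ℤ) ∣ N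
    have hb : ∀ p ∈ Q, ∃ b : ℤ, ∃ P ∈ S, ¬ (p : ℤ) ∣ ((φ P).map (eval x)).eval b := by
      intro p hp
      obtain ⟨hp, hpN⟩ := Finset.mem_filter.1 hp
      have hpp := Nat.prime_of_mem_primeFactors hp
      have hnot := mt (hx p hpp) hpN
      push Not at hnot
      obtain ⟨c, hc, hpc⟩ := hnot
      obtain ⟨P, hP, hcP⟩ := Finset.mem_biUnion.1 hc
      obtain ⟨k, -, rfl⟩ := Polynomial.mem_coeffs_iff.1 hcP
      have hdp : d < p := by
        by_contra! h
        exact hpN ((Int.natCast_dvd_natCast.2 (hpp.dvd_factorial.2 h)).trans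
          (dvd_of_mul_left_dvd hdvd))
      have hPd : (φ P).natDegree ≤ d := Finset.le_sup (f := fun P => (φ P).natDegree) hP
      obtain ⟨b, hb⟩ := ((φ P).map (eval x)).exists_not_dvd_eval_of_natDegree_lt hpp
        ((Polynomial.natDegree_map_le.trans hPd).trans_lt hdp) k (by rwa [Polynomial.coeff_map])
      exact ⟨b, P, hP, hb⟩
    have hb' : ∀ p : ℕ, ∃ b : ℤ, p ∈ Q → ∃ P ∈ S, ¬ (p : ℤ) ∣ ((φ P).map (eval x)).eval b := by
      intro p
      by_cases hp : p ∈ Q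
      · exact (hb p hp).imp fun b h _ => h
      · exact ⟨0, fun h => absurd h hp⟩
    choose b hb using hb'
    have hQ : ∀ p ∈ Q, p.Prime ∧ ¬ (p : ℤ) ∣ N := fun p hp =>
      ⟨Nat.prime_of_mem_primeFactors (Finset.mem_filter.1 hp).1, (Finset.mem_filter.1 hp).2⟩
    obtain ⟨y₀, hy₀N, hy₀Q⟩ := Int.exists_congr_of_forall_prime_not_dvd N (a 0) b Q hQ
    obtain ⟨y, hy, hyδ⟩ := Polynomial.exists_dvd_sub_eval_ne_zero
      (M := N * ∏ p ∈ Q, (p : ℤ)) (mul_ne_zero hN0 (Finset.prod_ne_zero_iff.2 fun p hp => by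
        exact_mod_cast (hQ p hp).1.ne_zero)) y₀ hδx
    refine ⟨Fin.cons y x, fun i => ?_, ?_, fun p hp hpS => ?_⟩
    · cases i using Fin.cases with
      | zero => simpa using dvd_add ((dvd_mul_right _ _).trans hy) hy₀N
      | succ i => simpa [Fin.tail] using hxa i
    · rwa [eval_eq_eval_mv_eval']
    · by_contra hpN
      have hev : ∀ P ∈ S, (p : ℤ) ∣ ((φ P).map (eval x)).eval y := fun P hP => by
        have := hpS P hP
        rwa [eval_eq_eval_mv_eval'] at this
      have hle : Ideal.span (φ '' (S : Set (MvPolynomial (Fin (r + 1)) ℤ))) ≤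
          (Ideal.span {(p : ℤ)}).comap
            ((Polynomial.evalRingHom y).comp (Polynomial.mapRingHom (eval x))) := by
        rw [Ideal.span_le]
        rintro _ ⟨P, hP, rfl⟩
        exact Ideal.mem_span_singleton.2 (hev P hP)
      have hpe : (p : ℤ) ∣ eval x ε := by
        simpa [Ideal.mem_comap, Ideal.mem_span_singleton] using hle hεS
      have hpQ : p ∈ Q := Finset.mem_filter.2
        ⟨Nat.mem_primeFactors.2 ⟨hp, Int.natCast_dvd.1 hpe, Int.natAbs_ne_zero.2 he⟩, hpN⟩
      obtain ⟨P, hP, hnot⟩ := hb p hpQ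
      refine hnot ?_
      have hpy : (p : ℤ) ∣ y - b p := by
        simpa using dvd_add (((Finset.dvd_prod_of_mem (fun p : ℕ => (p : ℤ)) hpQ).mul_left N).trans
          hy) (hy₀Q p hpQ)
      exact (dvd_sub_right (hev P hP)).1 (hpy.trans (Polynomial.sub_dvd_eval_sub _ _ _))

/-- Coprime polynomials without a fixed prime divisor assume coprime values. -/
theorem stmt1 (s r : ℕ) (hs : 2 ≤ s) (hr : 1 ≤ r)
    (P : Fin s → MvPolynomial (Fin r) ℤ)
    (hP : ∀ i, P i ≠ 0)
    (hcop : ∀ D : MvPolynomial (Fin r) ℚ,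
      (∀ i, D ∣ (P i).map (Int.castRingHom ℚ)) → D.totalDegree = 0)
    (hnofix : ¬ ∃ p : ℕ, p.Prime ∧ ∀ (i : Fin s) (n : Fin r → ℤ), (p : ℤ) ∣ eval n (P i)) :
    ∃ n₀ : Fin r → ℤ, (Finset.univ.gcd fun i => eval n₀ (P i)) = 1 := by
  classical
  obtain ⟨N, hN0, hN⟩ := MvPolynomial.exists_congr_forall_prime_dvd r (Finset.univ.image P) (by
    intro D hD
    replace hD : ∀ i, D ∣ P i := fun i => hD _ (Finset.mem_image_of_mem _ (Finset.mem_univ i))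
    have hdeg := hcop (D.map (Int.castRingHom ℚ)) fun i =>
      map_dvd (MvPolynomial.map (Int.castRingHom ℚ)) (hD i)
    rw [totalDegree_eq_zero_iff_eq_C, coeff_map, ← map_C] at hdeg
    have hDC := map_injective _ (RingHom.injective_int (Int.castRingHom ℚ)) hdeg
    refine ⟨_, fun h0 => hP ⟨0, by omega⟩ ?_, hDC⟩
    rw [h0, map_zero] at hDC
    exact zero_dvd_iff.1 (hDC ▸ hD _))
  push Not at hnofix
  have hchoice : ∀ p : ℕ, ∃ m : Fin r → ℤ, p.Prime → ∃ i, ¬ (p : ℤ) ∣ eval m (P i) := by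
    intro p
    by_cases hp : p.Prime
    · obtain ⟨i, m, h⟩ := hnofix p hp
      exact ⟨m, fun _ => ⟨i, h⟩⟩
    · exact ⟨0, fun h => absurd h hp⟩
  choose m hm using hchoice
  have hcrt : ∀ j : Fin r, ∃ y : ℤ, ∀ p ∈ N.natAbs.primeFactors, (p : ℤ) ∣ y - m p j := fun j => by
    obtain ⟨y, -, hy⟩ := Int.exists_congr_of_forall_prime_not_dvd 1 0 (fun p => m p j)
      N.natAbs.primeFactors fun p hp => by
        have hpp := Nat.prime_of_mem_primeFactors hp
        exact ⟨hpp, fun h => (Nat.prime_iff_prime_int.1 hpp).not_isUnit (isUnit_of_dvd_one h)⟩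
    exact ⟨y, hy⟩
  choose a ha using hcrt
  obtain ⟨n, hna, -, hn⟩ := hN N hN0 dvd_rfl a 1 one_ne_zero
  refine ⟨n, ?_⟩
  by_contra hg
  obtain ⟨p, hp, hpg⟩ := Int.exists_prime_and_dvd
    (n := Finset.univ.gcd fun i => eval n (P i)) (fun h => hg <| by
      rw [← Finset.normalize_gcd, ← Int.abs_eq_normalize, Int.abs_eq_natAbs, h, Nat.cast_one])
  have hpp : p.natAbs.Prime := Int.prime_iff_natAbs_prime.1 hp
  have hall : ∀ i, (p.natAbs : ℤ) ∣ eval n (P i) := fun i =>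
    Int.natAbs_dvd.2 (hpg.trans (Finset.gcd_dvd (Finset.mem_univ i)))
  have hpN : (p.natAbs : ℤ) ∣ N := hn _ hpp (by simpa using hall)
  obtain ⟨i, hi⟩ := hm _ hpp
  refine hi ((dvd_sub_right (hall i)).1 (dvd_eval_sub_eval (P i) fun j => ?_))
  simpa using dvd_add (hpN.trans (hna j)) (ha j _ (Nat.mem_primeFactors.2
    ⟨hpp, Int.natCast_dvd.1 hpN, Int.natAbs_ne_zero.2 hN0⟩))
end

section
/- (Ekedahl–Poonen density formula.) Let P_1,…,P_s ∈ ℤ[x_1,…,x_r] (s ≥ 2, r ≥ 1) be nonzero coprime polynomials, and let ℛ = {n ∈ ℤ^r : gcd(P_1(n),…,P_s(n)) = 1}. Then the density μ(ℛ) exists and equals the (convergent) infinite product ∏_{p prime} (1 − c_p/p^r); that is, #(ℛ ∩ [0,B−1]^r)/B^r converges as B → ∞ to the limit as M → ∞ of ∏_{p prime, p ≤ M} (1 − c_p/p^r). -/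
open MvPolynomial Filter

/-- A set of polynomials over a UFD, not all zero, whose common divisors are all constant,
generates an ideal containing a nonzero constant. -/
theorem exists_C_mem_span_of_common_dvd_natDegree_eq_zero {A : Type*} [CommRing A] [IsDomain A]
    [UniqueFactorizationMonoid A] (F : Set (Polynomial A)) (h0 : ∃ f ∈ F, f ≠ 0)
    (hF : ∀ D : Polynomial A, (∀ f ∈ F, D ∣ f) → D.natDegree = 0) :
    ∃ R : A, R ≠ 0 ∧ Polynomial.C R ∈ Ideal.span F := by
  classical
  let : NormalizationMonoid A := Nonempty.some inferInstance
  let : NormalizedGCDMonoid A := UniqueFactorizationMonoid.toNormalizedGCDMonoid A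
  let := Polynomial.algebra A (FractionRing A)
  have := Polynomial.isLocalization (nonZeroDivisors A) (FractionRing A)
  set K := FractionRing A
  set J : Ideal (Polynomial K) := Ideal.map (algebraMap (Polynomial A) (Polynomial K)) (Ideal.span F)
    with hJ
  have halg : ∀ f : Polynomial A, algebraMap (Polynomial A) (Polynomial K) f =
      f.map (algebraMap A K) := fun f => rfl
  have hinj : Function.Injective (algebraMap A K) := IsFractionRing.injective A K
  have hJtop : J = ⊤ := by
    obtain ⟨d, hd⟩ : ∃ d, J = Ideal.span {d} := ⟨_, (Ideal.span_singleton_generator J).symm⟩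
    have hdvd : ∀ f ∈ F, d ∣ f.map (algebraMap A K) := by
      intro f hf
      rw [← Ideal.mem_span_singleton, ← hd, ← halg]
      exact Ideal.mem_map_of_mem _ (Ideal.subset_span hf)
    have hd0 : d ≠ 0 := by
      rintro rfl
      obtain ⟨f, hf, hf0⟩ := h0
      exact hf0 ((Polynomial.map_eq_zero_iff hinj).1 (zero_dvd_iff.1 (hdvd f hf)))
    obtain ⟨b, hb, hbd⟩ := IsLocalization.integerNormalization_spec (nonZeroDivisors A) d
    set e := IsLocalization.integerNormalization (nonZeroDivisors A) d
    have hb0 : algebraMap A K b ≠ 0 := by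
      rw [Ne, map_eq_zero_iff _ hinj]
      exact nonZeroDivisors.ne_zero hb
    have hbd' : e.map (algebraMap A K) = Polynomial.C (algebraMap A K b) * d := by
      rw [hbd, ← Polynomial.smul_eq_C_mul, algebraMap_smul]
    have he0 : e ≠ 0 := by
      intro h
      rw [h, Polynomial.map_zero] at hbd'
      exact mul_ne_zero (Polynomial.C_ne_zero.2 hb0) hd0 hbd'.symm
    have hc0 : algebraMap A K e.content ≠ 0 := by
      rw [Ne, map_eq_zero_iff _ hinj, Polynomial.content_eq_zero_iff]
      exact he0
    have heq : Polynomial.C (algebraMap A K e.content) * e.primPart.map (algebraMap A K) =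
        Polynomial.C (algebraMap A K b) * d := by
      rw [← hbd', ← Polynomial.map_C, ← Polynomial.map_mul, ← Polynomial.eq_C_content_mul_primPart]
    have hu : IsUnit (Polynomial.C (algebraMap A K e.content)) :=
      Polynomial.isUnit_C.2 hc0.isUnit
    have hdeg : e.primPart.natDegree = 0 := by
      refine hF _ fun f hf => ?_
      refine e.isPrimitive_primPart.dvd_of_fraction_map_dvd_fraction_map (K := K) ?_
      refine dvd_trans ?_ (hdvd f hf)
      refine (Polynomial.isUnit_C.2 hb0.isUnit).dvd_mul_left.1 ?_
      rw [← heq]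
      exact dvd_mul_left _ _
    have hdd : d.natDegree = 0 := by
      have := congrArg Polynomial.natDegree heq
      rw [Polynomial.natDegree_C_mul hc0, Polynomial.natDegree_C_mul hb0,
        Polynomial.natDegree_map_eq_of_injective hinj, hdeg] at this
      exact this.symm
    rw [hd, Ideal.span_singleton_eq_top]
    exact Polynomial.isUnit_iff_degree_eq_zero.2
      (by rw [Polynomial.degree_eq_natDegree hd0, hdd]; rfl)
  have := (IsLocalization.map_algebraMap_ne_top_iff_disjoint
    ((nonZeroDivisors A).map (Polynomial.C : A →+* Polynomial A)) (Polynomial K)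
      (Ideal.span F)).not.1 (by rw [← hJ]; exact not_not.2 hJtop)
  obtain ⟨x, hx1, hx2⟩ := Set.not_disjoint_iff.1 this
  obtain ⟨R, hR, rfl⟩ := hx1
  exact ⟨R, nonZeroDivisors.ne_zero hR, hx2⟩

/-- A finite set of integer polynomials which is not contained in `{0}` and has only constant
common divisors. -/
def CoprimeFamily {k : ℕ} (F : Finset (MvPolynomial (Fin k) ℤ)) : Prop :=
  (∃ f ∈ F, f ≠ 0) ∧ ∀ D : MvPolynomial (Fin k) ℤ, (∀ f ∈ F, D ∣ f) → ∃ c, D = C c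

/-- All coefficients of the members of `F` regarded as polynomials in the first variable. -/
noncomputable def headCoeffs {k : ℕ} (F : Finset (MvPolynomial (Fin (k + 1)) ℤ)) :
    Finset (MvPolynomial (Fin k) ℤ) := by
  classical exact F.biUnion fun f => (finSuccEquiv ℤ k f).coeffs

theorem mem_headCoeffs {k : ℕ} {F : Finset (MvPolynomial (Fin (k + 1)) ℤ)}
    {c : MvPolynomial (Fin k) ℤ} :
    c ∈ headCoeffs F ↔ ∃ f ∈ F, ∃ j, (finSuccEquiv ℤ k f).coeff j ≠ 0 ∧
      c = (finSuccEquiv ℤ k f).coeff j := by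
  simp [headCoeffs, Polynomial.mem_coeffs_iff]

theorem exists_ne_zero_headCoeffs {k : ℕ} {F : Finset (MvPolynomial (Fin (k + 1)) ℤ)}
    (h : ∃ f ∈ F, f ≠ 0) : ∃ c ∈ headCoeffs F, c ≠ 0 := by
  obtain ⟨f, hf, hf0⟩ := h
  have h1 : finSuccEquiv ℤ k f ≠ 0 := by simpa using hf0
  have h2 := Polynomial.leadingCoeff_ne_zero.2 h1
  exact ⟨_, mem_headCoeffs.2 ⟨f, hf, _, h2, rfl⟩, h2⟩

theorem CoprimeFamily.headCoeffs {k : ℕ} {F : Finset (MvPolynomial (Fin (k + 1)) ℤ)}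
    (hF : CoprimeFamily F) : CoprimeFamily (headCoeffs F) := by
  refine ⟨exists_ne_zero_headCoeffs hF.1, fun D hD => ?_⟩
  obtain ⟨c, hc⟩ := hF.2 ((finSuccEquiv ℤ k).symm (Polynomial.C D)) fun f hf => by
    rw [← (finSuccEquiv ℤ k).symm_apply_apply f]
    refine map_dvd _ (Polynomial.C_dvd_iff_dvd_coeff _ _ |>.2 fun j => ?_)
    by_cases h : (finSuccEquiv ℤ k f).coeff j = 0
    · rw [h]; exact dvd_zero _
    · exact hD _ (mem_headCoeffs.2 ⟨f, hf, j, h, rfl⟩)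
  refine ⟨c, ?_⟩
  rw [AlgEquiv.symm_apply_eq] at hc
  have h2 : finSuccEquiv ℤ k (C c) = Polynomial.C (C c) := by
    simp
  rw [h2] at hc
  exact Polynomial.C_injective hc

theorem CoprimeFamily.exists_eliminant {k : ℕ} {F : Finset (MvPolynomial (Fin (k + 1)) ℤ)}
    (hF : CoprimeFamily F) :
    ∃ R : MvPolynomial (Fin k) ℤ, R ≠ 0 ∧ ∀ (d x : ℤ) (n : Fin k → ℤ),
      (∀ f ∈ F, d ∣ eval (Fin.cons x n) f) → d ∣ eval n R := by
  obtain ⟨R, hR, hmem⟩ := exists_C_mem_span_of_common_dvd_natDegree_eq_zero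
    (finSuccEquiv ℤ k '' (F : Set (MvPolynomial (Fin (k + 1)) ℤ))) (by
      obtain ⟨f, hf, hf0⟩ := hF.1
      exact ⟨_, ⟨f, hf, rfl⟩, by simpa using hf0⟩) (by
      intro D hD
      obtain ⟨c, hc⟩ := hF.2 ((finSuccEquiv ℤ k).symm D) fun f hf => by
        rw [← (finSuccEquiv ℤ k).symm_apply_apply f]
        exact map_dvd _ (hD _ ⟨f, hf, rfl⟩)
      rw [AlgEquiv.symm_apply_eq] at hc
      rw [hc]
      simp)
  refine ⟨R, hR, fun d x n h => ?_⟩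
  have key : Ideal.span (finSuccEquiv ℤ k '' (F : Set (MvPolynomial (Fin (k + 1)) ℤ))) ≤
      (Ideal.span {d}).comap
        ((Polynomial.evalRingHom x).comp (Polynomial.mapRingHom (eval n))) := by
    rw [Ideal.span_le]
    rintro _ ⟨f, hf, rfl⟩
    have := h f hf
    rw [eval_eq_eval_mv_eval'] at this
    simpa [Ideal.mem_span_singleton] using this
  have := key hmem
  simpa [Ideal.mem_span_singleton] using this

theorem coprimeFamily_image {s r : ℕ} (hs : 0 < s) (P : Fin s → MvPolynomial (Fin r) ℤ)
    (hP : ∀ i, P i ≠ 0)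
    (hcop : ∀ D : MvPolynomial (Fin r) ℚ,
      (∀ i, D ∣ (P i).map (Int.castRingHom ℚ)) → D.totalDegree = 0) :
    ∃ F : Finset (MvPolynomial (Fin r) ℤ), CoprimeFamily F ∧ ∀ f, f ∈ F ↔ ∃ i, P i = f := by
  classical
  refine ⟨Finset.univ.image P, ⟨⟨P ⟨0, hs⟩, by simp, hP _⟩, fun D hD => ?_⟩, by simp⟩
  have h := hcop (D.map (Int.castRingHom ℚ)) fun i => map_dvd (MvPolynomial.map _) (hD _ (by simp))
  rw [totalDegree, support_map_of_injective _ (RingHom.injective_int _)] at h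
  exact ⟨_, totalDegree_eq_zero_iff_eq_C.1 h⟩

/-- The integer points of `[0, N)^k`. -/
noncomputable def box (k N : ℕ) : Finset (Fin k → ℤ) := Fintype.piFinset fun _ => Finset.Ico 0 (N : ℤ)

theorem mem_box {k N : ℕ} {n : Fin k → ℤ} : n ∈ box k N ↔ ∀ j, 0 ≤ n j ∧ n j < N := by
  simp [box]

theorem card_box (k N : ℕ) : (box k N).card = N ^ k := by
  simp [box]

/-- All members of `F` are divisible by `p` at the point `n`. -/
def VanishMod {k : ℕ} (F : Finset (MvPolynomial (Fin k) ℤ)) (p : ℕ) (n : Fin k → ℤ) : Prop :=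
  ∀ f ∈ F, (p : ℤ) ∣ eval n f

open scoped Classical in
theorem card_box_succ_filter_le {k N d : ℕ} {S : (Fin (k + 1) → ℤ) → Prop}
    {T U : (Fin k → ℤ) → Prop}
    (hU : ∀ n ∈ box k N, ∀ x ∈ Finset.Ico 0 (N : ℤ), S (Fin.cons x n) → ¬ T n → U n)
    (hd : ∀ n ∈ box k N, ¬ T n → U n →
      ((Finset.Ico 0 (N : ℤ)).filter fun x => S (Fin.cons x n)).card ≤ d) :
    ((box (k + 1) N).filter S).card ≤
      N * ((box k N).filter T).card + d * ((box k N).filter U).card := by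
  have hmaps : Set.MapsTo (Fin.tail : (Fin (k + 1) → ℤ) → Fin k → ℤ)
      ((box (k + 1) N).filter S : Finset _) (box k N : Finset _) := by
    intro n hn
    have := (Finset.mem_filter.1 hn).1
    exact mem_box.2 fun j => mem_box.1 this j.succ
  rw [Finset.card_eq_sum_card_fiberwise hmaps, Finset.card_filter, Finset.card_filter,
    Finset.mul_sum, Finset.mul_sum, ← Finset.sum_add_distrib]
  refine Finset.sum_le_sum fun n hn => ?_
  have hle : (((box (k + 1) N).filter S).filter fun a => Fin.tail a = n).card ≤
      ((Finset.Ico 0 (N : ℤ)).filter fun x => S (Fin.cons x n)).card := by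
    refine Finset.card_le_card_of_injOn (fun a => a 0) ?_ ?_
    · intro a ha
      simp only [Finset.coe_filter, Finset.mem_filter, Set.mem_ofPred_eq] at ha
      obtain ⟨⟨h1, h2⟩, rfl⟩ := ha
      simpa [Fin.cons_self_tail, h2] using mem_box.1 h1 0
    · intro a ha b hb hab
      simp only [Finset.coe_filter, Finset.mem_filter, Set.mem_ofPred_eq] at ha hb
      rw [← Fin.cons_self_tail a, ← Fin.cons_self_tail b, ha.2, hb.2]
      exact congrArg (fun x => (Fin.cons x n : Fin (k + 1) → ℤ)) hab
  refine hle.trans ?_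
  by_cases hT : T n
  · have : ((Finset.Ico 0 (N : ℤ)).filter fun x => S (Fin.cons x n)).card ≤ N :=
      (Finset.card_filter_le _ _).trans (by simp)
    simp only [hT, if_true]
    omega
  · by_cases hUn : U n
    · simpa [hT, hUn] using hd n hn hT hUn
    · rw [Finset.filter_false_of_mem fun x hx hS => hUn (hU n hn x hx hS hT)]
      simp

open scoped Classical in
theorem exists_card_fiber_le {k : ℕ} (F : Finset (MvPolynomial (Fin (k + 1)) ℤ)) :
    ∃ d : ℕ, ∀ (p N : ℕ), p.Prime → N ≤ p → ∀ n : Fin k → ℤ, ¬ VanishMod (headCoeffs F) p n →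
      ((Finset.Ico 0 (N : ℤ)).filter fun x => VanishMod F p (Fin.cons x n)).card ≤ d := by
  refine ⟨F.sup fun f => (finSuccEquiv ℤ k f).natDegree, fun p N hp hN n hn => ?_⟩
  have : Fact p.Prime := ⟨hp⟩
  simp only [VanishMod, not_forall] at hn
  obtain ⟨c, hc, hpc⟩ := hn
  obtain ⟨f, hf, j, -, rfl⟩ := mem_headCoeffs.1 hc
  set g : Polynomial (ZMod p) :=
    ((finSuccEquiv ℤ k f).map (eval n)).map (Int.castRingHom (ZMod p)) with hg
  have hg0 : g ≠ 0 := by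
    intro h
    have := congrArg (fun q => Polynomial.coeff q j) h
    simp only [hg, Polynomial.coeff_map, Polynomial.coeff_zero, eq_intCast,
      ZMod.intCast_zmod_eq_zero_iff_dvd] at this
    exact hpc this
  calc _ ≤ g.roots.toFinset.card := by
        refine Finset.card_le_card_of_injOn (fun x : ℤ => (x : ZMod p)) ?_ ?_
        · intro x hx
          have hx2 := (Finset.mem_filter.1 hx).2 f hf
          rw [eval_eq_eval_mv_eval', ← ZMod.intCast_zmod_eq_zero_iff_dvd] at hx2
          rw [Finset.mem_coe, Multiset.mem_toFinset, Polynomial.mem_roots hg0,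
            Polynomial.IsRoot, hg]
          change Polynomial.eval (Int.castRingHom (ZMod p) x) _ = 0
          rw [Polynomial.eval_map_apply]
          exact hx2
        · intro x hx y hy hxy
          have hx1 := Finset.mem_Ico.1 (Finset.mem_filter.1 hx).1
          have hy1 := Finset.mem_Ico.1 (Finset.mem_filter.1 hy).1
          have := (ZMod.intCast_eq_intCast_iff x y p).1 hxy
          rwa [Int.ModEq, Int.emod_eq_of_lt hx1.1 (by omega),
            Int.emod_eq_of_lt hy1.1 (by omega)] at this
    _ ≤ g.natDegree := (Multiset.toFinset_card_le _).trans (Polynomial.card_roots' _)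
    _ ≤ (finSuccEquiv ℤ k f).natDegree :=
        Polynomial.natDegree_map_le.trans Polynomial.natDegree_map_le
    _ ≤ _ := Finset.le_sup (f := fun f => (finSuccEquiv ℤ k f).natDegree) hf

theorem exists_prime_le_of_vanishMod_fin_zero {F : Finset (MvPolynomial (Fin 0) ℤ)}
    (hF : ∃ f ∈ F, f ≠ 0) : ∃ c : ℕ, ∀ p n, VanishMod F p n → p ≤ c := by
  obtain ⟨f, hf, hf0⟩ := hF
  obtain ⟨c, rfl⟩ := C_surjective (R := ℤ) (Fin 0) f
  have hc0 : c ≠ 0 := by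
    rintro rfl
    simp at hf0
  refine ⟨c.natAbs, fun p n h => ?_⟩
  have := h _ hf
  rw [eval_C, Int.natCast_dvd] at this
  exact Nat.le_of_dvd (Int.natAbs_pos.2 hc0) this

open scoped Classical in
theorem exists_card_vanishMod_mul_le (k : ℕ) (F : Finset (MvPolynomial (Fin k) ℤ))
    (hF : ∃ f ∈ F, f ≠ 0) :
    ∃ C : ℕ, ∀ p N : ℕ, p.Prime → N ≤ p →
      ((box k N).filter (VanishMod F p)).card * N ≤ C * N ^ k := by
  induction k with
  | zero =>
    obtain ⟨c, hc⟩ := exists_prime_le_of_vanishMod_fin_zero hF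
    refine ⟨c, fun p N hp hN => ?_⟩
    by_cases h : ((box 0 N).filter (VanishMod F p)).card = 0
    · simp [h]
    · obtain ⟨n, hn⟩ := Finset.card_pos.1 (Nat.pos_of_ne_zero h)
      have hpc := hc p n (Finset.mem_filter.1 hn).2
      have : ((box 0 N).filter (VanishMod F p)).card ≤ 1 :=
        (Finset.card_filter_le _ _).trans (by simp [card_box])
      calc _ ≤ 1 * N := by gcongr
        _ ≤ _ := by simp; omega
  | succ k ih =>
    obtain ⟨C, hC⟩ := ih (headCoeffs F) (exists_ne_zero_headCoeffs hF)
    obtain ⟨d, hd⟩ := exists_card_fiber_le F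
    refine ⟨C + d, fun p N hp hN => ?_⟩
    have h := card_box_succ_filter_le (k := k) (N := N) (d := d) (S := VanishMod F p)
      (T := VanishMod (headCoeffs F) p) (U := fun _ => True) (by simp)
      (fun n _ hn _ => hd p N hp hN n hn)
    rw [Finset.filter_true, card_box] at h
    calc _ ≤ (N * ((box k N).filter (VanishMod (headCoeffs F) p)).card + d * N ^ k) * N := by
          gcongr
      _ = N * (((box k N).filter (VanishMod (headCoeffs F) p)).card * N) + d * N ^ k * N := by ring
      _ ≤ N * (C * N ^ k) + d * N ^ k * N := by gcongr N * ?_ + _; exact hC p N hp hN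
      _ = _ := by ring

open scoped Classical in
theorem exists_card_zeros_mul_le {k : ℕ} {R : MvPolynomial (Fin k) ℤ} (hR : R ≠ 0) :
    ∃ C : ℕ, ∀ N : ℕ, ((box k N).filter fun n => eval n R = 0).card * N ≤ C * N ^ k := by
  obtain ⟨C, hC⟩ := exists_card_vanishMod_mul_le k {R} ⟨R, by simp, hR⟩
  refine ⟨C, fun N => ?_⟩
  obtain ⟨p, hNp, hp⟩ := Nat.exists_infinite_primes N
  refine le_trans ?_ (hC p N hp hNp)
  gcongr with n
  intro h
  simp [VanishMod, h]

open scoped Classical in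
theorem CoprimeFamily.exists_card_vanishMod_mul_sq_le {k : ℕ}
    {F : Finset (MvPolynomial (Fin k) ℤ)} (hF : CoprimeFamily F) :
    ∃ C : ℕ, ∀ p N : ℕ, p.Prime → N ≤ p →
      ((box k N).filter (VanishMod F p)).card * N ^ 2 ≤ C * N ^ k := by
  induction k with
  | zero =>
    obtain ⟨c, hc⟩ := exists_prime_le_of_vanishMod_fin_zero hF.1
    refine ⟨c ^ 2, fun p N hp hN => ?_⟩
    by_cases h : ((box 0 N).filter (VanishMod F p)).card = 0
    · simp [h]
    · obtain ⟨n, hn⟩ := Finset.card_pos.1 (Nat.pos_of_ne_zero h)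
      have hpc := hc p n (Finset.mem_filter.1 hn).2
      have : ((box 0 N).filter (VanishMod F p)).card ≤ 1 :=
        (Finset.card_filter_le _ _).trans (by simp [card_box])
      calc _ ≤ 1 * c ^ 2 := by gcongr; omega
        _ ≤ _ := by simp
  | succ k ih =>
    obtain ⟨C, hC⟩ := ih hF.headCoeffs
    obtain ⟨R, hR0, hR⟩ := hF.exists_eliminant
    obtain ⟨C', hC'⟩ := exists_card_vanishMod_mul_le k {R} ⟨R, by simp, hR0⟩
    obtain ⟨d, hd⟩ := exists_card_fiber_le F
    refine ⟨C + d * C', fun p N hp hN => ?_⟩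
    have h := card_box_succ_filter_le (k := k) (N := N) (d := d) (S := VanishMod F p)
      (T := VanishMod (_root_.headCoeffs F) p) (U := VanishMod {R} p)
      (fun n _ x _ hS _ => by simpa [VanishMod] using hR p x n hS)
      (fun n _ hn _ => hd p N hp hN n hn)
    calc _ ≤ (N * ((box k N).filter (VanishMod (_root_.headCoeffs F) p)).card +
            d * ((box k N).filter (VanishMod {R} p)).card) * N ^ 2 := by gcongr
      _ = N * (((box k N).filter (VanishMod (_root_.headCoeffs F) p)).card * N ^ 2) +
            d * N * (((box k N).filter (VanishMod {R} p)).card * N) := by ring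
      _ ≤ N * (C * N ^ k) + d * N * (C' * N ^ k) := by
          gcongr N * ?_ + d * N * ?_
          · exact hC p N hp hN
          · exact hC' p N hp hN
      _ = _ := by ring

theorem exists_natAbs_eval_le {k : ℕ} (R : MvPolynomial (Fin k) ℤ) :
    ∃ C e : ℕ, ∀ N : ℕ, 1 ≤ N → ∀ n ∈ box k N, (eval n R).natAbs ≤ C * N ^ e := by
  induction R using MvPolynomial.induction_on with
  | C a => exact ⟨a.natAbs, 0, fun N _ n _ => by simp⟩
  | add p q hp hq =>
    obtain ⟨C, e, h⟩ := hp
    obtain ⟨C', e', h'⟩ := hq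
    refine ⟨C + C', e + e', fun N hN n hn => ?_⟩
    rw [map_add]
    calc _ ≤ (eval n p).natAbs + (eval n q).natAbs := Int.natAbs_add_le _ _
      _ ≤ C * N ^ e + C' * N ^ e' := add_le_add (h N hN n hn) (h' N hN n hn)
      _ ≤ C * N ^ (e + e') + C' * N ^ (e + e') := by gcongr <;> omega
      _ = _ := by ring
  | mul_X p i hp =>
    obtain ⟨C, e, h⟩ := hp
    refine ⟨C, e + 1, fun N hN n hn => ?_⟩
    have := mem_box.1 hn i
    rw [map_mul, eval_X, Int.natAbs_mul]
    calc _ ≤ C * N ^ e * N := Nat.mul_le_mul (h N hN n hn) (by omega)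
      _ = _ := by ring

/-- A nonzero integer of size `C * N ^ e` has few prime factors `p ≥ N`. -/
theorem card_primeFactors_filter_le {C e N m : ℕ} (hN : 2 ≤ N) (hm : m ≠ 0)
    (h : m ≤ C * N ^ e) : (m.primeFactors.filter fun p => N ≤ p).card ≤ C + e := by
  set s := m.primeFactors.filter fun p => N ≤ p with hs
  by_contra! hlt
  have h1 : N ^ s.card ≤ m :=
    calc N ^ s.card ≤ ∏ p ∈ s, p :=
          Finset.pow_card_le_prod _ _ _ fun p hp => (Finset.mem_filter.1 hp).2
      _ ≤ m := Nat.le_of_dvd (Nat.pos_of_ne_zero hm)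
          ((Finset.prod_dvd_prod_of_subset _ _ _ (Finset.filter_subset _ _)).trans
            m.prod_primeFactors_dvd)
  have h2 : N ^ C * N ^ e ≤ C * N ^ e := by
    rw [← pow_add]
    exact (Nat.pow_le_pow_right (by omega) hlt.le).trans (h1.trans h)
  have h3 : N ^ C ≤ C := Nat.le_of_mul_le_mul_right h2 (by positivity)
  exact absurd h3 (not_le.2 (Nat.lt_pow_self (by omega)))

open scoped Classical in
theorem CoprimeFamily.exists_card_exists_large_prime_mul_le {k : ℕ}
    {F : Finset (MvPolynomial (Fin k) ℤ)} (hF : CoprimeFamily F) :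
    ∃ C : ℕ, ∀ N : ℕ, 2 ≤ N →
      ((box k N).filter fun n => ∃ p, p.Prime ∧ N ≤ p ∧ VanishMod F p n).card * N ≤
        C * N ^ k := by
  induction k with
  | zero =>
    obtain ⟨c, hc⟩ := exists_prime_le_of_vanishMod_fin_zero hF.1
    refine ⟨c, fun N _ => ?_⟩
    set S := (box 0 N).filter fun n => ∃ p, p.Prime ∧ N ≤ p ∧ VanishMod F p n
    by_cases h : S.card = 0
    · simp [h]
    · obtain ⟨n, hn⟩ := Finset.card_pos.1 (Nat.pos_of_ne_zero h)
      obtain ⟨p, -, hNp, hp⟩ := (Finset.mem_filter.1 hn).2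
      have hpc := hc p n hp
      have : S.card ≤ 1 := (Finset.card_filter_le _ _).trans (by simp [card_box])
      calc _ ≤ 1 * N := by gcongr
        _ ≤ _ := by simp; omega
  | succ k ih =>
    obtain ⟨C, hC⟩ := ih hF.headCoeffs
    obtain ⟨R, hR0, hR⟩ := hF.exists_eliminant
    obtain ⟨C', hC'⟩ := exists_card_zeros_mul_le hR0
    obtain ⟨d, hd⟩ := exists_card_fiber_le F
    obtain ⟨A, e, hA⟩ := exists_natAbs_eval_le R
    refine ⟨C + C' + (A + e) * d, fun N hN => ?_⟩
    have h := card_box_succ_filter_le (k := k) (N := N) (d := (A + e) * d)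
      (S := fun n => ∃ p, p.Prime ∧ N ≤ p ∧ VanishMod F p n)
      (T := fun n => (∃ p, p.Prime ∧ N ≤ p ∧ VanishMod (_root_.headCoeffs F) p n) ∨ eval n R = 0)
      (U := fun _ => True) (by simp) (by
        intro n hn hT _
        push Not at hT
        refine le_trans (Finset.card_le_card ?_) ((Finset.card_biUnion_le_card_mul
          ((eval n R).natAbs.primeFactors.filter fun p => N ≤ p)
          (fun p => (Finset.Ico 0 (N : ℤ)).filter fun x => VanishMod F p (Fin.cons x n)) d ?_).trans
          ?_)
        · intro x hx
          obtain ⟨hx, p, hp, hNp, hv⟩ := Finset.mem_filter.1 hx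
          refine Finset.mem_biUnion.2 ⟨p, ?_, Finset.mem_filter.2 ⟨hx, hv⟩⟩
          refine Finset.mem_filter.2 ⟨Nat.mem_primeFactors.2 ⟨hp, ?_, by simpa using hT.2⟩, hNp⟩
          exact Int.natCast_dvd.1 (hR p x n hv)
        · intro p hp
          obtain ⟨hp, hNp⟩ := Finset.mem_filter.1 hp
          have hp := Nat.prime_of_mem_primeFactors hp
          exact hd p N hp hNp n (hT.1 p hp hNp)
        · gcongr
          exact card_primeFactors_filter_le hN (by simpa using hT.2) (hA N (by omega) n hn))
    rw [Finset.filter_true, card_box] at h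
    have h' := h.trans (Nat.add_le_add_right
      (Nat.mul_le_mul_left N ((Finset.card_le_card ?_).trans (Finset.card_union_le
        ((box k N).filter fun n => ∃ p, p.Prime ∧ N ≤ p ∧ VanishMod (_root_.headCoeffs F) p n)
        ((box k N).filter fun n => eval n R = 0)))) _)
    swap
    · intro n hn
      simp only [Finset.mem_union, Finset.mem_filter] at hn ⊢
      rwa [← and_or_left]
    have h1 := hC N hN
    have h2 := hC' N
    set a := ((box k N).filter
      fun n => ∃ p, p.Prime ∧ N ≤ p ∧ VanishMod (_root_.headCoeffs F) p n).card
    set b := ((box k N).filter fun n => eval n R = 0).card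
    calc _ ≤ (N * (a + b) + (A + e) * d * N ^ k) * N := by gcongr
      _ = N * (a * N) + N * (b * N) + (A + e) * d * N ^ k * N := by ring
      _ ≤ N * (C * N ^ k) + N * (C' * N ^ k) + (A + e) * d * N ^ k * N := by gcongr N * ?_ + N * ?_ + _
      _ = _ := by ring

theorem intCast_eval_eq {k m : ℕ} (n : Fin k → ℤ) (f : MvPolynomial (Fin k) ℤ) :
    ((eval n f : ℤ) : ZMod m) =
      eval (fun j => (n j : ZMod m)) (f.map (Int.castRingHom (ZMod m))) := by
  induction f using MvPolynomial.induction_on with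
  | C a => simp
  | add p q hp hq => simp [hp, hq]
  | mul_X p i hp => simp [hp]

theorem vanishMod_iff {k p : ℕ} {F : Finset (MvPolynomial (Fin k) ℤ)} {n : Fin k → ℤ} :
    VanishMod F p n ↔ ∀ f ∈ F,
      eval (fun j => (n j : ZMod p)) (f.map (Int.castRingHom (ZMod p))) = 0 := by
  simp_rw [VanishMod, ← ZMod.intCast_zmod_eq_zero_iff_dvd, intCast_eval_eq]

open scoped Classical in
theorem card_vanishMod_le_pow_mul {k p : ℕ} (hp : 0 < p) (F : Finset (MvPolynomial (Fin k) ℤ))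
    (N : ℕ) : ((box k N).filter (VanishMod F p)).card ≤
      (N / p + 1) ^ k * ((box k p).filter (VanishMod F p)).card := by
  have hp' : (0 : ℤ) < p := by exact_mod_cast hp
  refine Finset.card_le_mul_card_image_of_maps_to (f := fun n j => n j % (p : ℤ)) ?_ _ ?_
  · intro n hn
    obtain ⟨hn, hv⟩ := Finset.mem_filter.1 hn
    refine Finset.mem_filter.2 ⟨mem_box.2 fun j =>
      ⟨Int.emod_nonneg _ hp'.ne', Int.emod_lt_of_pos _ hp'⟩, ?_⟩
    rw [vanishMod_iff] at hv ⊢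
    simpa using hv
  · intro b _
    rw [← card_box]
    refine Finset.card_le_card_of_injOn (fun n j => n j / (p : ℤ)) ?_ ?_
    · intro n hn
      have hn := mem_box.1 (Finset.mem_filter.1 (Finset.mem_filter.1 hn).1).1
      refine mem_box.2 fun j => ⟨Int.ediv_nonneg (hn j).1 hp'.le, ?_⟩
      push_cast
      exact Int.lt_add_one_of_le (Int.ediv_le_ediv hp' (hn j).2.le)
    · intro n hn n' hn' h
      have h1 := (Finset.mem_filter.1 hn).2
      have h2 := (Finset.mem_filter.1 hn').2
      funext j
      rw [← Int.mul_ediv_add_emod (n j) p, ← Int.mul_ediv_add_emod (n' j) p]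
      have h3 := congrFun h j
      have h4 := congrFun (h1.trans h2.symm) j
      simp only at h3 h4
      rw [h3, h4]

open scoped Classical in
theorem CoprimeFamily.exists_card_vanishMod_le {k : ℕ}
    {F : Finset (MvPolynomial (Fin k) ℤ)} (hF : CoprimeFamily F) :
    ∃ C : ℝ, 0 ≤ C ∧ ∀ p N : ℕ, p.Prime → p ≤ N →
      (((box k N).filter (VanishMod F p)).card : ℝ) ≤ C * N ^ k * ((p : ℝ) ^ 2)⁻¹ := by
  obtain ⟨C, hC⟩ := hF.exists_card_vanishMod_mul_sq_le
  refine ⟨C * 2 ^ k, by positivity, fun p N hp hpN => ?_⟩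
  have hp0 : (0 : ℝ) < p := by exact_mod_cast hp.pos
  rw [← div_eq_mul_inv, le_div_iff₀ (by positivity)]
  have h : ((box k N).filter (VanishMod F p)).card * p ^ 2 ≤ C * 2 ^ k * N ^ k :=
    calc _ ≤ (N / p + 1) ^ k * ((box k p).filter (VanishMod F p)).card * p ^ 2 := by
          gcongr
          exact card_vanishMod_le_pow_mul hp.pos F N
      _ = (N / p + 1) ^ k * (((box k p).filter (VanishMod F p)).card * p ^ 2) := by ring
      _ ≤ (N / p + 1) ^ k * (C * p ^ k) := by
          gcongr _ * ?_
          exact hC p p hp le_rfl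
      _ = C * (N / p * p + p) ^ k := by rw [← Nat.add_one_mul (N / p) p, mul_pow]; ring
      _ ≤ C * (2 * N) ^ k := by
          gcongr
          have := Nat.div_mul_le_self N p
          omega
      _ = _ := by ring
  exact_mod_cast h

open scoped Classical in
theorem CoprimeFamily.exists_card_exists_prime_gt_le {k : ℕ}
    {F : Finset (MvPolynomial (Fin k) ℤ)} (hF : CoprimeFamily F) :
    ∃ C : ℝ, ∀ M N : ℕ, 2 ≤ N →
      (((box k N).filter fun n => ∃ p, p.Prime ∧ M < p ∧ VanishMod F p n).card : ℝ) ≤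
        (C / (M + 1) + C / N) * N ^ k := by
  obtain ⟨C, hC0, hC⟩ := hF.exists_card_vanishMod_le
  obtain ⟨C', hC'⟩ := hF.exists_card_exists_large_prime_mul_le
  refine ⟨2 * C + C', fun M N hN => ?_⟩
  set L := (box k N).filter fun n => ∃ p, p.Prime ∧ N ≤ p ∧ VanishMod F p n
  set I := (Finset.Ioo M N).filter Nat.Prime
  have hN0 : (0 : ℝ) < N := by positivity
  have hsub : ((box k N).filter fun n => ∃ p, p.Prime ∧ M < p ∧ VanishMod F p n) ⊆
      (I.biUnion fun p => (box k N).filter (VanishMod F p)) ∪ L := by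
    intro n hn
    obtain ⟨hn, p, hp, hMp, hv⟩ := Finset.mem_filter.1 hn
    rw [Finset.mem_union]
    by_cases hpN : p < N
    · exact .inl (Finset.mem_biUnion.2 ⟨p, Finset.mem_filter.2 ⟨Finset.mem_Ioo.2 ⟨hMp, hpN⟩, hp⟩,
        Finset.mem_filter.2 ⟨hn, hv⟩⟩)
    · exact .inr (Finset.mem_filter.2 ⟨hn, p, hp, not_lt.1 hpN, hv⟩)
  have hcard := (Finset.card_le_card hsub).trans ((Finset.card_union_le _ _).trans
    (Nat.add_le_add_right Finset.card_biUnion_le _))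
  have hcard' : (((box k N).filter fun n => ∃ p, p.Prime ∧ M < p ∧ VanishMod F p n).card : ℝ) ≤
      ∑ p ∈ I, (((box k N).filter (VanishMod F p)).card : ℝ) + L.card := by
    exact_mod_cast hcard
  have hsum : ∑ p ∈ I, (((box k N).filter (VanishMod F p)).card : ℝ) ≤
      C * N ^ k * (2 / (M + 1)) :=
    calc _ ≤ ∑ p ∈ I, C * N ^ k * ((p : ℝ) ^ 2)⁻¹ := by
          refine Finset.sum_le_sum fun p hp => ?_
          obtain ⟨h1, h2⟩ := Finset.mem_filter.1 hp
          exact hC p N h2 (Finset.mem_Ioo.1 h1).2.le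
      _ ≤ ∑ p ∈ Finset.Ioo M N, C * N ^ k * ((p : ℝ) ^ 2)⁻¹ :=
          Finset.sum_le_sum_of_subset_of_nonneg (Finset.filter_subset _ _)
            fun _ _ _ => by positivity
      _ = C * N ^ k * ∑ p ∈ Finset.Ioo M N, ((p : ℝ) ^ 2)⁻¹ := by rw [Finset.mul_sum]
      _ ≤ _ := by
          gcongr
          exact sum_Ioo_inv_sq_le M N
  have hlarge : (L.card : ℝ) ≤ C' / N * N ^ k := by
    rw [div_mul_eq_mul_div, le_div_iff₀ hN0]
    exact_mod_cast hC' N hN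
  have e1 : (0 : ℝ) ≤ C' / (M + 1) * N ^ k := by positivity
  have e2 : (0 : ℝ) ≤ 2 * C / N * N ^ k := by positivity
  calc _ ≤ C * N ^ k * (2 / (M + 1)) + C' / N * N ^ k := by linarith
    _ ≤ C * N ^ k * (2 / (M + 1)) + C' / N * N ^ k + C' / (M + 1) * N ^ k +
        2 * C / N * N ^ k := by linarith
    _ = _ := by ring

theorem tendsto_card_filter_intCast_eq {Q : ℕ} (hQ : 0 < Q) (a : ZMod Q) :
    Tendsto (fun B : ℕ =>
      (((Finset.Ico 0 (B : ℤ)).filter fun x : ℤ => (x : ZMod Q) = a).card : ℝ) / B)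
      atTop (nhds (1 / Q)) := by
  obtain ⟨v, rfl⟩ := ZMod.intCast_surjective a
  have hQ' : (0 : ℝ) < Q := by exact_mod_cast hQ
  have key : ∀ B : ℕ,
      |(((Finset.Ico 0 (B : ℤ)).filter fun x : ℤ => (x : ZMod Q) = v).card : ℝ) - B / Q| ≤ 1 := by
    intro B
    simp_rw [ZMod.intCast_eq_intCast_iff]
    have h := Int.Ico_filter_modEq_card 0 (B : ℤ) (r := Q) (by exact_mod_cast hQ) v
    set c := ((Finset.Ico 0 (B : ℤ)).filter fun x : ℤ => x ≡ v [ZMOD Q]).card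
    have h1 : (c : ℤ) = ⌈((B : ℤ) - (v : ℤ) : ℚ) / ((Q : ℤ) : ℚ)⌉ -
        ⌈(((0 : ℤ) : ℚ) - (v : ℤ) : ℚ) / ((Q : ℤ) : ℚ)⌉ := by
      rw [h, max_eq_left]
      rw [sub_nonneg]
      gcongr
      positivity
    have a1 := Int.le_ceil (((B : ℤ) - (v : ℤ) : ℚ) / ((Q : ℤ) : ℚ))
    have a2 := Int.ceil_lt_add_one (((B : ℤ) - (v : ℤ) : ℚ) / ((Q : ℤ) : ℚ))
    have a3 := Int.le_ceil ((((0 : ℤ) : ℚ) - (v : ℤ) : ℚ) / ((Q : ℤ) : ℚ))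
    have a4 := Int.ceil_lt_add_one ((((0 : ℤ) : ℚ) - (v : ℤ) : ℚ) / ((Q : ℤ) : ℚ))
    have h2 : (c : ℚ) = (⌈((B : ℤ) - (v : ℤ) : ℚ) / ((Q : ℤ) : ℚ)⌉ : ℚ) -
        (⌈(((0 : ℤ) : ℚ) - (v : ℤ) : ℚ) / ((Q : ℤ) : ℚ)⌉ : ℚ) := by exact_mod_cast h1
    have h3 : |(c : ℚ) - B / Q| ≤ 1 := by
      rw [sub_div] at a1 a2 a3 a4
      rw [sub_div, sub_div] at h2
      simp only [Int.cast_natCast, Int.cast_zero, zero_div] at *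
      rw [abs_le]
      constructor <;> linarith
    have h4 : ((|(c : ℚ) - B / Q| : ℚ) : ℝ) ≤ ((1 : ℚ) : ℝ) := Rat.cast_le.2 h3
    push_cast at h4
    exact h4
  refine tendsto_iff_norm_sub_tendsto_zero.2 (squeeze_zero' (.of_forall fun _ => norm_nonneg _) ?_
    tendsto_one_div_atTop_nhds_zero_nat)
  filter_upwards [eventually_gt_atTop 0] with B hB
  have hB' : (0 : ℝ) < B := by exact_mod_cast hB
  rw [le_div_iff₀ hB', Real.norm_eq_abs, ← abs_of_pos hB', ← abs_mul, abs_of_pos hB']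
  refine le_trans (le_of_eq ?_) (key B)
  congr 1
  field_simp

open scoped Classical in
theorem tendsto_card_filter_periodic {k Q : ℕ} [NeZero Q] (G : (Fin k → ZMod Q) → Prop) :
    Tendsto (fun B : ℕ =>
      (((box k B).filter fun n => G fun j => (n j : ZMod Q)).card : ℝ) / (B : ℝ) ^ k)
      atTop (nhds ((Nat.card {a // G a} : ℝ) / (Q : ℝ) ^ k)) := by
  have hclass : ∀ (B : ℕ) (a : Fin k → ZMod Q),
      ((box k B).filter fun n => (fun j => (n j : ZMod Q)) = a).card =
        ∏ j, ((Finset.Ico 0 (B : ℤ)).filter fun x : ℤ => (x : ZMod Q) = a j).card := by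
    intro B a
    rw [← Fintype.card_piFinset]
    congr 1
    ext n
    simp [mem_box, funext_iff, forall_and]
  have hsum : ∀ B : ℕ, (((box k B).filter fun n => G fun j => (n j : ZMod Q)).card : ℝ) /
      (B : ℝ) ^ k = ∑ a ∈ Finset.univ.filter G, ∏ j,
        ((((Finset.Ico 0 (B : ℤ)).filter fun x : ℤ => (x : ZMod Q) = a j).card : ℝ) / B) := by
    intro B
    rw [Finset.card_eq_sum_card_fiberwise (f := fun n j => (n j : ZMod Q))
      (t := Finset.univ.filter G) (by intro n hn; simpa using (Finset.mem_filter.1 hn).2)]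
    push_cast
    rw [Finset.sum_div]
    refine Finset.sum_congr rfl fun a ha => ?_
    rw [Finset.prod_div_distrib, Finset.prod_const, Finset.card_univ, Fintype.card_fin,
      ← Nat.cast_prod, ← hclass, Finset.filter_filter]
    congr 3
    refine Finset.filter_congr fun n _ => ?_
    refine ⟨fun h => h.2, fun h => ⟨?_, h⟩⟩
    rw [h]
    exact (Finset.mem_filter.1 ha).2
  simp_rw [hsum]
  have hval : (Nat.card {a // G a} : ℝ) / (Q : ℝ) ^ k =
      ∑ a ∈ Finset.univ.filter G, ∏ _j : Fin k, (1 / (Q : ℝ)) := by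
    rw [Finset.sum_const, Finset.prod_const, Finset.card_univ, Fintype.card_fin,
      Nat.subtype_card (Finset.univ.filter G) (by simp)]
    simp [div_eq_mul_inv]
  rw [hval]
  exact tendsto_finsetSum _ fun a _ => tendsto_finsetProd _ fun j _ =>
    tendsto_card_filter_intCast_eq (NeZero.pos Q) (a j)

/-- The local density at `p` of the points where not all members of `F` vanish modulo `p`. -/
noncomputable def localDensity {k : ℕ} (F : Finset (MvPolynomial (Fin k) ℤ)) (p : ℕ) : ℝ :=
  1 - (Nat.card {n : Fin k → ZMod p //
    ∀ f ∈ F, eval n (f.map (Int.castRingHom (ZMod p))) = 0} : ℝ) / (p : ℝ) ^ k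

theorem card_not_vanish_div_pow {k : ℕ} (F : Finset (MvPolynomial (Fin k) ℤ)) {p : ℕ}
    (hp : 0 < p) :
    (Nat.card {n : Fin k → ZMod p //
      ¬ ∀ f ∈ F, eval n (f.map (Int.castRingHom (ZMod p))) = 0} : ℝ) / (p : ℝ) ^ k =
      localDensity F p := by
  classical
  have : NeZero p := ⟨hp.ne'⟩
  have hp' : (p : ℝ) ^ k ≠ 0 := by positivity
  have h := Nat.card_congr (Equiv.sumCompl fun n : Fin k → ZMod p =>
    ∀ f ∈ F, eval n (f.map (Int.castRingHom (ZMod p))) = 0)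
  rw [Nat.card_sum, Nat.card_fun, Nat.card_zmod, Nat.card_fin] at h
  rw [localDensity, eq_sub_iff_add_eq, ← add_div, div_eq_one_iff_eq hp', add_comm]
  exact_mod_cast h

theorem localDensity_nonneg {k : ℕ} (F : Finset (MvPolynomial (Fin k) ℤ)) {p : ℕ}
    (hp : 0 < p) : 0 ≤ localDensity F p := by
  rw [← card_not_vanish_div_pow F hp]
  positivity

theorem localDensity_le_one {k : ℕ} (F : Finset (MvPolynomial (Fin k) ℤ)) (p : ℕ) :
    localDensity F p ≤ 1 := by
  rw [localDensity, sub_le_self_iff]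
  positivity

open scoped Classical in
theorem tendsto_card_not_vanishMod_finset {k : ℕ} (F : Finset (MvPolynomial (Fin k) ℤ))
    (s : Finset ℕ) (hs : ∀ p ∈ s, p.Prime) :
    Tendsto (fun B : ℕ =>
      (((box k B).filter fun n => ∀ p ∈ s, ¬ VanishMod F p n).card : ℝ) / (B : ℝ) ^ k)
      atTop (nhds (∏ p ∈ s, localDensity F p)) := by
  have hpos : ∀ p : s, 0 < (p : ℕ) := fun p => (hs p p.2).pos
  have hQ : NeZero (∏ p : s, (p : ℕ)) := ⟨(Finset.prod_pos fun p _ => hpos p).ne'⟩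
  have hco : Pairwise (Function.onFun Nat.Coprime fun p : s => (p : ℕ)) := fun p q hpq =>
    (Nat.coprime_primes (hs p p.2) (hs q q.2)).2 fun h => hpq (Subtype.ext h)
  set e := ZMod.prodEquivPi (fun p : s => (p : ℕ)) hco
  set H : ∀ p : s, (Fin k → ZMod p) → Prop := fun p n =>
    ¬ ∀ f ∈ F, eval n (f.map (Int.castRingHom (ZMod p))) = 0 with hH
  have h := tendsto_card_filter_periodic (k := k) (Q := ∏ p : s, (p : ℕ))
    fun a => ∀ p : s, H p fun j => e (a j) p
  have hcard : Nat.card {a : Fin k → ZMod (∏ p : s, (p : ℕ)) //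
      ∀ p : s, H p fun j => e (a j) p} = ∏ p : s, Nat.card {n // H p n} := by
    rw [← Nat.card_pi]
    refine Nat.card_congr (Equiv.trans (Equiv.subtypeEquiv
      ((Equiv.piCongrRight fun _ : Fin k => e.toEquiv).trans
        (Equiv.piComm fun _ (p : s) => ZMod p)) ?_) (Equiv.subtypePiEquivPi (p := fun {p} n => H p n)))
    intro a
    rfl
  have hlim : (Nat.card {a : Fin k → ZMod (∏ p : s, (p : ℕ)) //
      ∀ p : s, H p fun j => e (a j) p} : ℝ) / ((∏ p : s, (p : ℕ) : ℕ) : ℝ) ^ k =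
        ∏ p ∈ s, localDensity F p := by
    rw [hcard, ← Finset.prod_coe_sort s (localDensity F)]
    push_cast
    rw [← Finset.prod_pow, ← Finset.prod_div_distrib]
    exact Finset.prod_congr rfl fun p _ => card_not_vanish_div_pow F (hpos p)
  rw [hlim] at h
  refine h.congr fun B => ?_
  congr 3
  ext n
  simp only [Finset.mem_filter, hH, map_intCast, Pi.intCast_apply, vanishMod_iff, Subtype.forall]

theorem finset_gcd_eq_one_iff {ι : Type*} {s : Finset ι} {f : ι → ℤ} :
    s.gcd f = 1 ↔ ∀ p : ℕ, p.Prime → ¬ ∀ i ∈ s, (p : ℤ) ∣ f i := by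
  simp_rw [← Finset.dvd_gcd_iff]
  constructor
  · intro h p hp hdvd
    rw [h] at hdvd
    exact hp.one_lt.ne' (Nat.dvd_one.1 (by exact_mod_cast hdvd))
  · intro h
    have h1 : (s.gcd f).natAbs = 1 := by
      by_contra hne
      obtain ⟨p, hp, hdvd⟩ := Nat.exists_prime_and_dvd hne
      exact h p hp (Int.natCast_dvd.2 hdvd)
    have h2 := Int.nonneg_of_normalize_eq_self (Finset.normalize_gcd (s := s) (f := f))
    omega

open scoped Classical in
theorem CoprimeFamily.tendsto_density {k : ℕ} {F : Finset (MvPolynomial (Fin k) ℤ)}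
    (hF : CoprimeFamily F) :
    ∃ L : ℝ,
      Tendsto (fun M : ℕ => ∏ p ∈ (Finset.Iic M).filter Nat.Prime, localDensity F p)
        atTop (nhds L) ∧
      Tendsto (fun B : ℕ =>
        (((box k B).filter fun n => ∀ p : ℕ, p.Prime → ¬ VanishMod F p n).card : ℝ) / (B : ℝ) ^ k)
        atTop (nhds L) := by
  set A : ℕ → ℝ := fun M => ∏ p ∈ (Finset.Iic M).filter Nat.Prime, localDensity F p with hA
  have hnn : ∀ p : ℕ, p.Prime → 0 ≤ localDensity F p := fun p hp => localDensity_nonneg F hp.pos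
  have hanti : Antitone A := by
    refine antitone_nat_of_succ_le fun M => ?_
    have hA' : ∀ M, A M = ∏ p ∈ Finset.range (M + 1), if p.Prime then localDensity F p else 1 := by
      intro M
      simp only [hA]
      rw [Finset.prod_filter]
      congr 1
      ext p
      simp
    have h0 : 0 ≤ A M := Finset.prod_nonneg fun p hp => hnn p (Finset.mem_filter.1 hp).2
    rw [hA' (M + 1), Finset.prod_range_succ, ← hA']
    refine mul_le_of_le_one_right h0 ?_
    split_ifs
    · exact localDensity_le_one F _
    · exact le_rfl
  have hbdd : BddBelow (Set.range A) := ⟨0, by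
    rintro _ ⟨M, rfl⟩
    exact Finset.prod_nonneg fun p hp => hnn p (Finset.mem_filter.1 hp).2⟩
  have hlim := tendsto_atTop_ciInf hanti hbdd
  refine ⟨⨅ M, A M, hlim, ?_⟩
  set L := ⨅ M, A M
  obtain ⟨C, hC⟩ := hF.exists_card_exists_prime_gt_le
  rw [Metric.tendsto_atTop']
  intro ε hε
  have hM0 : Tendsto (fun M : ℕ => C / ((M : ℝ) + 1)) atTop (nhds 0) :=
    tendsto_const_nhds.div_atTop (tendsto_natCast_atTop_atTop.atTop_add tendsto_const_nhds)
  have hB0 : Tendsto (fun B : ℕ => C / (B : ℝ)) atTop (nhds 0) :=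
    tendsto_const_nhds.div_atTop tendsto_natCast_atTop_atTop
  have hε4 : 0 < ε / 4 := by positivity
  obtain ⟨M, hM1, hM2⟩ := ((hlim.eventually (Metric.ball_mem_nhds L hε4)).and
    (hM0.eventually (gt_mem_nhds hε4))).exists
  have hM3 := tendsto_card_not_vanishMod_finset F ((Finset.Iic M).filter Nat.Prime)
    fun p hp => (Finset.mem_filter.1 hp).2
  obtain ⟨B₀, hB₀⟩ := eventually_atTop.1 ((hM3.eventually (Metric.ball_mem_nhds _ hε4)).and
    ((hB0.eventually (gt_mem_nhds hε4)).and (eventually_ge_atTop 2)))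
  refine ⟨B₀, fun B hB => ?_⟩
  obtain ⟨h1, h2, h3⟩ := hB₀ B hB.le
  have hBk : (0 : ℝ) < (B : ℝ) ^ k := by positivity
  set X := (box k B).filter fun n => ∀ p : ℕ, p.Prime → ¬ VanishMod F p n
  set Y := (box k B).filter fun n => ∀ p ∈ (Finset.Iic M).filter Nat.Prime, ¬ VanishMod F p n
  set Z := (box k B).filter fun n => ∃ p, p.Prime ∧ M < p ∧ VanishMod F p n
  have hXY : X ⊆ Y := fun n hn => Finset.mem_filter.2 ⟨(Finset.mem_filter.1 hn).1,
    fun p hp => (Finset.mem_filter.1 hn).2 p (Finset.mem_filter.1 hp).2⟩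
  have hYXZ : Y ⊆ X ∪ Z := by
    intro n hn
    obtain ⟨hn, hY⟩ := Finset.mem_filter.1 hn
    rw [Finset.mem_union]
    by_cases hZ : ∃ p, p.Prime ∧ M < p ∧ VanishMod F p n
    · exact .inr (Finset.mem_filter.2 ⟨hn, hZ⟩)
    · refine .inl (Finset.mem_filter.2 ⟨hn, fun p hp hv => ?_⟩)
      by_cases hpM : p ≤ M
      · exact hY p (Finset.mem_filter.2 ⟨Finset.mem_Iic.2 hpM, hp⟩) hv
      · exact hZ ⟨p, hp, not_le.1 hpM, hv⟩
  have c1 : (X.card : ℝ) / B ^ k ≤ Y.card / B ^ k := by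
    gcongr
  have c2 : (Y.card : ℝ) / B ^ k ≤ X.card / B ^ k + (C / (M + 1) + C / B) := by
    rw [div_le_iff₀ hBk, add_mul, div_mul_cancel₀ _ hBk.ne']
    have : (Y.card : ℝ) ≤ X.card + Z.card := by
      exact_mod_cast (Finset.card_le_card hYXZ).trans (Finset.card_union_le _ _)
    have := hC M B h3
    linarith
  change dist (A M) L < ε / 4 at hM1
  change dist (_ : ℝ) (A M) < ε / 4 at h1
  rw [Real.dist_eq, abs_lt] at h1 hM1 ⊢
  constructor <;> linarith

/-- Ekedahl–Poonen density formula: the density of the set of integer points where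
the coprime polynomials `P i` take coprime values exists and equals the convergent
infinite product `∏_p (1 - c_p / p^r)`. -/
theorem stmt3 (s r : ℕ) (hs : 2 ≤ s) (hr : 1 ≤ r)
    (P : Fin s → MvPolynomial (Fin r) ℤ)
    (hP : ∀ i, P i ≠ 0)
    (hcop : ∀ D : MvPolynomial (Fin r) ℚ,
      (∀ i, D ∣ (P i).map (Int.castRingHom ℚ)) → D.totalDegree = 0) :
    ∃ L : ℝ,
      Tendsto (fun M : ℕ =>
        ∏ p ∈ (Finset.Iic M).filter Nat.Prime,
          (1 - (Nat.card {n : Fin r → ZMod p //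
              ∀ i, eval n ((P i).map (Int.castRingHom (ZMod p))) = 0} : ℝ) / (p : ℝ) ^ r))
        atTop (nhds L) ∧
      Tendsto (fun B : ℕ =>
        (Nat.card {n : Fin r → ℤ // (∀ j, 0 ≤ n j ∧ n j < (B : ℤ)) ∧
            (Finset.univ.gcd fun i => eval n (P i)) = 1} : ℝ) / (B : ℝ) ^ r)
        atTop (nhds L) := by
  classical
  obtain ⟨F, hF, hmem⟩ := coprimeFamily_image (by omega) P hP hcop
  obtain ⟨L, hL1, hL2⟩ := hF.tendsto_density
  refine ⟨L, ?_, ?_⟩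
  · simpa [localDensity, hmem] using hL1
  · refine hL2.congr fun B => ?_
    rw [Nat.subtype_card ((box r B).filter fun n => ∀ p : ℕ, p.Prime → ¬ VanishMod F p n)]
    intro n
    simp [finset_gcd_eq_one_iff, mem_box, VanishMod, hmem]
end
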